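/- arXiv:2009.10889 — 4 statements merged into one kernel-verified Lean document; each statement's English description precedes it below -/
import Mathlib

section
/- Let p be an odd prime, d ≥ 1, q = p^d, and n ≥ 1. Let K be an algebraically closed field with char K ≠ p. Then there is a K-algebra isomorphism between the group algebras K[Sp_{2n}(𝔽_q[t]/t²)] and K[Sp_{2n}(W₂(𝔽_q))], where Sp_{2n}(R) is the symplectic group of 2n×2n matrices M over R satisfying Mᵀ J M = J for the standard symplectic form J, 𝔽_q[t]/t² is the ring of dual numbers DualNumber (GaloisField p d), and W₂(𝔽_q) = TruncatedWittVector p 2 (GaloisField p d) is the ring of Witt vectors of length two. -/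
open Matrix

namespace GroupExtension

variable {K G N Γ : Type*} [Field K] [Group G] [CommGroup N] [Group Γ]

/-- The action of `G` on functions on the characters of `N`, induced by an action `φ` of `G`
on `N`. -/
def charFunMap (K : Type*) [Field K] (φ : G →* MulAut N) (g : G) :
    ((N →* Kˣ) → K) →ₐ[K] ((N →* Kˣ) → K) where
  toFun f χ := f (χ.comp (φ g).toMonoidHom)
  map_one' := rfl
  map_mul' _ _ := rfl
  map_zero' := rfl
  map_add' _ _ := rfl
  commutes' _ := rfl

/-- Evaluation of characters at an element of `N`. -/
def charEval (K N : Type*) [Field K] [CommGroup N] : N →* ((N →* Kˣ) → K) where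
  toFun n χ := (χ n : K)
  map_one' := by ext; simp
  map_mul' _ _ := by ext; simp

theorem charFunMap_charEval (φ : G →* MulAut N) (g : G) (n : N) :
    charFunMap K φ g (charEval K N n) = charEval K N (φ g n) := rfl

/-- A choice-free form of the condition that `χ` extends to its stabilizer in `Γ`. -/
def ExtendsToStabilizer (S : GroupExtension N Γ G) (φ : G →* MulAut N) (χ : N →* Kˣ) : Prop :=
  ∃ Λ : Γ → Kˣ, (∀ n, Λ (S.inl n) = χ n) ∧
    ∀ a b, χ.comp (φ (S.rightHom a)).toMonoidHom = χ →
      χ.comp (φ (S.rightHom b)).toMonoidHom = χ → Λ (a * b) = Λ a * Λ b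

theorem comp_map_mul (φ : G →* MulAut N) (χ : N →* Kˣ) (g h : G) :
    χ.comp (φ (g * h)).toMonoidHom =
      (χ.comp (φ g).toMonoidHom).comp (φ h).toMonoidHom := by
  ext; simp

theorem comp_map_one (φ : G →* MulAut N) (χ : N →* Kˣ) :
    χ.comp (φ 1).toMonoidHom = χ := by
  ext; simp

/-- Orbit representatives for the action of `G` on the characters of `N`. -/
theorem exists_orbit_representatives (S : GroupExtension N Γ G) (φ : G →* MulAut N) :
    ∃ (r : (N →* Kˣ) → (N →* Kˣ)) (s : (N →* Kˣ) → Γ),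
      (∀ χ, χ.comp (φ (S.rightHom (s χ))).toMonoidHom = r χ) ∧
      ∀ χ g, r (χ.comp (φ g).toMonoidHom) = r χ := by
  let st : Setoid (N →* Kˣ) :=
    { r := fun χ χ' => ∃ g : G, χ.comp (φ g).toMonoidHom = χ'
      iseqv := by
        refine ⟨fun χ => ⟨1, comp_map_one φ χ⟩, ?_, ?_⟩
        · rintro χ _ ⟨g, rfl⟩
          exact ⟨g⁻¹, by rw [← comp_map_mul, mul_inv_cancel, comp_map_one]⟩
        · rintro χ _ _ ⟨g, rfl⟩ ⟨h, rfl⟩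
          exact ⟨g * h, comp_map_mul φ χ g h⟩ }
  have h : ∀ χ : N →* Kˣ, ∃ γ : Γ,
      χ.comp (φ (S.rightHom γ)).toMonoidHom = (Quotient.mk st χ).out := by
    intro χ
    obtain ⟨g, hg⟩ : st.r χ (Quotient.mk st χ).out :=
      st.symm (Quotient.mk_out χ)
    obtain ⟨γ, rfl⟩ := S.rightHom_surjective g
    exact ⟨γ, hg⟩
  choose s hs using h
  refine ⟨fun χ => (Quotient.mk st χ).out, s, hs, fun χ g => ?_⟩
  have : Quotient.mk st (χ.comp (φ g).toMonoidHom) = Quotient.mk st χ :=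
    Quotient.sound (st.symm ⟨g, rfl⟩)
  exact congrArg Quotient.out this

/-- If all characters of `N` extend to their stabilizers, then the evaluation map extends to a
`1`-cocycle of `Γ` with values in the units of the functions on the characters of `N`. -/
theorem exists_cocycle (S : GroupExtension N Γ G) (φ : G →* MulAut N)
    (hφ : ∀ γ n, S.inl (φ (S.rightHom γ) n) = γ * S.inl n * γ⁻¹)
    (hext : ∀ χ : N →* Kˣ, ExtendsToStabilizer S φ χ) :
    ∃ c : Γ → (N →* Kˣ) → Kˣ, (∀ n χ, c (S.inl n) χ = χ n) ∧
      ∀ γ δ χ, c (γ * δ) χ = c γ χ * c δ (χ.comp (φ (S.rightHom γ)).toMonoidHom) := by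
  choose Λ hΛ hmul using hext
  obtain ⟨r, s, hs, hr⟩ := exists_orbit_representatives (K := K) S φ
  have hs' (χ : N →* Kˣ) : (r χ).comp (φ (S.rightHom (s χ))⁻¹).toMonoidHom = χ := by
    rw [← hs, ← comp_map_mul, mul_inv_cancel, comp_map_one]
  have hstab (γ : Γ) (χ : N →* Kˣ) : (r χ).comp (φ (S.rightHom
      ((s χ)⁻¹ * γ * s (χ.comp (φ (S.rightHom γ)).toMonoidHom)))).toMonoidHom = r χ := by
    rw [map_mul, comp_map_mul, map_mul, comp_map_mul, map_inv, hs', hs, hr]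
  refine ⟨fun γ χ => Λ (r χ) ((s χ)⁻¹ * γ * s (χ.comp (φ (S.rightHom γ)).toMonoidHom)),
    fun n χ => ?_, fun γ δ χ => ?_⟩
  · have h1 : S.rightHom (S.inl n) = 1 := S.rightHom_inl n
    have h2 : (s χ)⁻¹ * S.inl n * s χ = S.inl (φ (S.rightHom (s χ)⁻¹) n) := by
      rw [hφ, inv_inv]
    beta_reduce
    rw [h1, comp_map_one, h2, hΛ, map_inv]
    exact DFunLike.congr_fun (hs' χ) n
  · have h := hmul (r χ) _ _ (hstab γ χ)
      (hr χ (S.rightHom γ) ▸ hstab δ (χ.comp (φ (S.rightHom γ)).toMonoidHom))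
    beta_reduce
    rw [hr, ← h, map_mul, comp_map_mul]
    congr 1
    group

theorem lift_charEval_bijective [Finite N] [HasEnoughRootsOfUnity K (Monoid.exponent N)] :
    Function.Bijective (MonoidAlgebra.lift K ((N →* Kˣ) → K) N (charEval K N)) := by
  classical
  have hcard : Nat.card (N →* Kˣ) = Nat.card N :=
    CommGroup.card_monoidHom_of_hasEnoughRootsOfUnity N K
  have : Finite (N →* Kˣ) := Nat.finite_of_card_ne_zero (hcard ▸ Nat.card_pos.ne')
  have := Fintype.ofFinite N
  have := Fintype.ofFinite (N →* Kˣ)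
  have hspan : Submodule.span K (Set.range fun (χ : N →* Kˣ) (n : N) => (χ n : K)) = ⊤ := by
    refine LinearIndependent.span_eq_top_of_card_eq_finrank' ?_ ?_
    · refine (linearIndependent_monoidHom N K).comp
        (fun χ : N →* Kˣ => (Units.coeHom K).comp χ) fun χ χ' h => ?_
      ext n
      exact DFunLike.congr_fun h n
    · rw [Module.finrank_fintype_fun_eq_card, ← Nat.card_eq_fintype_card,
        ← Nat.card_eq_fintype_card, hcard]
  have hinj : Function.Injective (MonoidAlgebra.lift K ((N →* Kˣ) → K) N (charEval K N)) := by
    rw [injective_iff_map_eq_zero]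
    intro a ha
    have hzero : ∀ v : N → K, ∑ n, a.coeff n * v n = 0 := by
      intro v
      have hv : v ∈ Submodule.span K (Set.range fun (χ : N →* Kˣ) (n : N) => (χ n : K)) :=
        hspan ▸ Submodule.mem_top
      induction hv using Submodule.span_induction with
      | mem v hv =>
        obtain ⟨χ, rfl⟩ := hv
        have := congrFun ha χ
        rw [MonoidAlgebra.lift_apply, Finsupp.sum_fintype _ _ (by simp)] at this
        simpa [charEval, Finset.sum_apply] using this
      | zero => simp
      | add v w _ _ hv hw => simp [mul_add, Finset.sum_add_distrib, hv, hw]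
      | smul c v _ hv => simp [mul_left_comm, ← Finset.mul_sum, hv]
    ext n
    simpa [Pi.single_apply] using hzero (Pi.single n 1)
  refine ⟨hinj, ?_⟩
  refine (LinearMap.injective_iff_surjective_of_finrank_eq_finrank
    (f := (MonoidAlgebra.lift K ((N →* Kˣ) → K) N (charEval K N)).toLinearMap) ?_).1 hinj
  rw [Module.finrank_eq_card_basis (MonoidAlgebra.basis N K), Module.finrank_fintype_fun_eq_card,
    ← Nat.card_eq_fintype_card, ← Nat.card_eq_fintype_card, hcard]

/-- A cocycle extending evaluation exhibits the group algebra of an extension as a skew group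
algebra. -/
theorem exists_skew_decomposition [Finite N] [HasEnoughRootsOfUnity K (Monoid.exponent N)]
    (S : GroupExtension N Γ G) (φ : G →* MulAut N)
    (hφ : ∀ γ n, S.inl (φ (S.rightHom γ) n) = γ * S.inl n * γ⁻¹)
    (c : Γ → (N →* Kˣ) → Kˣ) (hc : ∀ n χ, c (S.inl n) χ = χ n)
    (hmul : ∀ γ δ χ, c (γ * δ) χ = c γ χ * c δ (χ.comp (φ (S.rightHom γ)).toMonoidHom)) :
    ∃ (ι : ((N →* Kˣ) → K) →ₐ[K] MonoidAlgebra K Γ) (w : G →* MonoidAlgebra K Γ),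
      (∀ n, ι (charEval K N n) = MonoidAlgebra.of K Γ (S.inl n)) ∧
      (∀ g f, w g * ι f = ι (charFunMap K φ g f) * w g) ∧
      ∀ γ, MonoidAlgebra.of K Γ γ = ι (fun χ => c γ χ) * w (S.rightHom γ) := by
  let F := AlgEquiv.ofBijective _ (lift_charEval_bijective (K := K) (N := N))
  let ι : ((N →* Kˣ) → K) →ₐ[K] MonoidAlgebra K Γ :=
    (MonoidAlgebra.lift K _ N ((MonoidAlgebra.of K Γ).comp S.inl)).comp F.symm.toAlgHom
  have hF (n : N) : F (MonoidAlgebra.of K N n) = charEval K N n := by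
    simp [F]
  have hι (n : N) : ι (charEval K N n) = MonoidAlgebra.of K Γ (S.inl n) := by
    have : F.symm (charEval K N n) = MonoidAlgebra.of K N n := by
      rw [← hF, AlgEquiv.symm_apply_apply]
    simp [ι, this]
  have hcomm (γ : Γ) (f) : MonoidAlgebra.of K Γ γ * ι f =
      ι (charFunMap K φ (S.rightHom γ) f) * MonoidAlgebra.of K Γ γ := by
    obtain ⟨a, rfl⟩ := F.surjective f
    induction a using MonoidAlgebra.induction_on with
    | of n =>
      rw [hF, charFunMap_charEval, hι, hι, ← map_mul, ← map_mul, hφ]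
      simp
    | add a b ha hb => simp only [map_add, mul_add, add_mul, ha, hb]
    | smul r a ha => simp only [map_smul, mul_smul_comm, smul_mul_assoc, ha]
  choose s hs using S.rightHom_surjective
  let u (γ : Γ) : (N →* Kˣ) → K := fun χ => c γ χ
  let v (γ : Γ) : (N →* Kˣ) → K := fun χ => ((c γ χ)⁻¹ : Kˣ)
  have huv (γ) : u γ * v γ = 1 := by ext χ; simp [u, v]
  have hvu (γ) : v γ * u γ = 1 := by ext χ; simp [u, v]
  let w (g : G) : MonoidAlgebra K Γ := ι (v (s g)) * MonoidAlgebra.of K Γ (s g)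
  have humul (γ δ) : u (γ * δ) = u γ * charFunMap K φ (S.rightHom γ) (u δ) := by
    ext χ; simp [u, hmul, charFunMap]
  have hof (γ : Γ) : MonoidAlgebra.of K Γ γ = ι (u γ) * w (S.rightHom γ) := by
    obtain ⟨n, hn⟩ : γ * (s (S.rightHom γ))⁻¹ ∈ S.inl.range := by
      rw [S.range_inl_eq_ker_rightHom, MonoidHom.mem_ker, map_mul, map_inv, hs, mul_inv_cancel]
    have hγ : γ = S.inl n * s (S.rightHom γ) := by rw [hn, inv_mul_cancel_right]
    have h1 : u γ = charEval K N n * u (s (S.rightHom γ)) := by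
      conv_lhs => rw [hγ]
      rw [humul, S.rightHom_inl]
      ext χ
      simp only [Pi.mul_apply, u, hc, charEval, charFunMap, AlgHom.coe_mk, RingHom.coe_mk,
        MonoidHom.coe_mk, OneHom.coe_mk, comp_map_one]
    rw [h1, map_mul, mul_assoc, ← mul_assoc (ι (u _)), ← map_mul, huv, map_one, one_mul, hι,
      ← map_mul, ← hγ]
  have hw (g : G) (f) : w g * ι f = ι (charFunMap K φ g f) * w g := by
    simp only [w]
    rw [mul_assoc, hcomm, hs, ← mul_assoc, ← mul_assoc, ← map_mul, ← map_mul, mul_comm (v _)]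
  have hwof (γ : Γ) : w (S.rightHom γ) = ι (v γ) * MonoidAlgebra.of K Γ γ := by
    rw [hof, ← mul_assoc, ← map_mul, hvu, map_one, one_mul]
  refine ⟨ι, ⟨⟨w, ?_⟩, fun g h => ?_⟩, hι, hw, hof⟩
  · have h1 : w 1 = ι (v 1) * MonoidAlgebra.of K Γ 1 := by rw [← hwof, map_one]
    have h2 : v 1 = 1 := by
      ext χ
      have := hc 1 χ
      rw [map_one, map_one] at this
      simp [v, this]
    rw [h1, h2, map_one, map_one, mul_one]
  · obtain ⟨γ, rfl⟩ := S.rightHom_surjective g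
    obtain ⟨δ, rfl⟩ := S.rightHom_surjective h
    change w _ = w _ * w _
    calc w (S.rightHom γ * S.rightHom δ)
        = ι (v (γ * δ)) * (ι (u γ) * w (S.rightHom γ) * (ι (u δ) * w (S.rightHom δ))) := by
          rw [← map_mul, hwof (γ * δ), ← hof, ← hof, map_mul (MonoidAlgebra.of K Γ)]
      _ = ι (v (γ * δ)) * (ι (u γ) * (w (S.rightHom γ) * ι (u δ)) * w (S.rightHom δ)) := by
          simp only [mul_assoc]
      _ = ι (v (γ * δ) * (u γ * charFunMap K φ (S.rightHom γ) (u δ))) *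
            (w (S.rightHom γ) * w (S.rightHom δ)) := by
          rw [hw]
          simp only [map_mul, mul_assoc]
      _ = w (S.rightHom γ) * w (S.rightHom δ) := by
          rw [← humul, hvu, map_one, one_mul]

theorem algHom_ext_charEval [Finite N] [HasEnoughRootsOfUnity K (Monoid.exponent N)]
    {A : Type*} [Semiring A] [Algebra K A] {f g : ((N →* Kˣ) → K) →ₐ[K] A}
    (h : ∀ n, f (charEval K N n) = g (charEval K N n)) : f = g := by
  rw [← AlgHom.cancel_right (lift_charEval_bijective (K := K) (N := N)).surjective]
  ext n
  simpa using h n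

/-- A skew decomposition of the group algebra gives it the universal property of the skew group
algebra. -/
theorem exists_algHom_of_skew_decomposition [Finite N]
    [HasEnoughRootsOfUnity K (Monoid.exponent N)] {A : Type*} [Ring A] [Algebra K A]
    (S : GroupExtension N Γ G) (φ : G →* MulAut N)
    (c : Γ → (N →* Kˣ) → Kˣ) (hc : ∀ n χ, c (S.inl n) χ = χ n)
    (hmul : ∀ γ δ χ, c (γ * δ) χ = c γ χ * c δ (χ.comp (φ (S.rightHom γ)).toMonoidHom))
    (ι : ((N →* Kˣ) → K) →ₐ[K] MonoidAlgebra K Γ) (w : G →* MonoidAlgebra K Γ)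
    (hι : ∀ n, ι (charEval K N n) = MonoidAlgebra.of K Γ (S.inl n))
    (hof : ∀ γ, MonoidAlgebra.of K Γ γ = ι (fun χ => c γ χ) * w (S.rightHom γ))
    (ι' : ((N →* Kˣ) → K) →ₐ[K] A) (w' : G →* A)
    (hw' : ∀ g f, w' g * ι' f = ι' (charFunMap K φ g f) * w' g) :
    ∃ Φ : MonoidAlgebra K Γ →ₐ[K] A, (∀ f, Φ (ι f) = ι' f) ∧ ∀ g, Φ (w g) = w' g := by
  let u (γ : Γ) : (N →* Kˣ) → K := fun χ => c γ χ
  have hu (n : N) : u (S.inl n) = charEval K N n := by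
    ext χ; simp [u, hc, charEval]
  have humul (γ δ) : u (γ * δ) = u γ * charFunMap K φ (S.rightHom γ) (u δ) := by
    ext χ; simp [u, hmul, charFunMap]
  let θ : Γ →* A :=
    { toFun γ := ι' (u γ) * w' (S.rightHom γ)
      map_one' := by rw [← map_one S.inl, hu]; simp
      map_mul' γ δ := by
        rw [humul, map_mul, map_mul, map_mul, mul_assoc, mul_assoc, ← mul_assoc (w' _), hw',
          mul_assoc] }
  let Φ := MonoidAlgebra.lift K A Γ θ
  have hΦ (γ : Γ) : Φ (MonoidAlgebra.of K Γ γ) = ι' (u γ) * w' (S.rightHom γ) := by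
    simp [Φ, θ]
  have hΦι : Φ.comp ι = ι' := by
    refine algHom_ext_charEval fun n => ?_
    rw [AlgHom.comp_apply, hι, hΦ, S.rightHom_inl, map_one, mul_one, hu]
  refine ⟨Φ, fun f => DFunLike.congr_fun hΦι f, fun g => ?_⟩
  obtain ⟨γ, rfl⟩ := S.rightHom_surjective g
  have hunit : IsUnit (ι' (u γ)) := by
    refine IsUnit.map ι' (Pi.isUnit_iff.2 fun χ => (c γ χ).isUnit)
  refine hunit.mul_left_cancel ?_
  rw [← hΦ, hof, map_mul, ← AlgHom.comp_apply, hΦι]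

theorem nonempty_groupAlgebra_algEquiv {Γ' : Type*} [Group Γ'] [Finite N]
    [HasEnoughRootsOfUnity K (Monoid.exponent N)]
    (S : GroupExtension N Γ G) (S' : GroupExtension N Γ' G) (φ : G →* MulAut N)
    (hφ : ∀ γ n, S.inl (φ (S.rightHom γ) n) = γ * S.inl n * γ⁻¹)
    (hφ' : ∀ γ n, S'.inl (φ (S'.rightHom γ) n) = γ * S'.inl n * γ⁻¹)
    (hext : ∀ χ : N →* Kˣ, ExtendsToStabilizer S φ χ)
    (hext' : ∀ χ : N →* Kˣ, ExtendsToStabilizer S' φ χ) :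
    Nonempty (MonoidAlgebra K Γ ≃ₐ[K] MonoidAlgebra K Γ') := by
  obtain ⟨c, hc, hmul⟩ := exists_cocycle S φ hφ hext
  obtain ⟨c', hc', hmul'⟩ := exists_cocycle S' φ hφ' hext'
  obtain ⟨ι, w, hι, hw, hof⟩ := exists_skew_decomposition S φ hφ c hc hmul
  obtain ⟨ι', w', hι', hw', hof'⟩ := exists_skew_decomposition S' φ hφ' c' hc' hmul'
  obtain ⟨Φ, hΦι, hΦw⟩ := exists_algHom_of_skew_decomposition S φ c hc hmul ι w hι hof ι' w' hw'
  obtain ⟨Ψ, hΨι, hΨw⟩ :=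
    exists_algHom_of_skew_decomposition S' φ c' hc' hmul' ι' w' hι' hof' ι w hw
  refine ⟨AlgEquiv.ofAlgHom Φ Ψ ?_ ?_⟩
  · refine (MonoidAlgebra.lift K _ _).symm.injective (MonoidHom.ext fun γ => ?_)
    change Φ (Ψ (MonoidAlgebra.of K Γ' γ)) = MonoidAlgebra.of K Γ' γ
    rw [hof', map_mul, map_mul, hΨι, hΨw, hΦι, hΦw]
  · refine (MonoidAlgebra.lift K _ _).symm.injective (MonoidHom.ext fun γ => ?_)
    change Ψ (Φ (MonoidAlgebra.of K Γ γ)) = MonoidAlgebra.of K Γ γ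
    rw [hof, map_mul, map_mul, hΦι, hΦw, hΨι, hΨw]

end GroupExtension

/-- A homomorphism on a subgroup of index prime to `p` which is invariant and of exponent `p` on a
normal subgroup extends from this normal subgroup to the whole group. -/
theorem Subgroup.exists_extension_of_coprime_index {H A : Type*} [Group H] [CommGroup A]
    (M P : Subgroup H) [M.Normal] [P.FiniteIndex] (hMP : M ≤ P) (ψ : P →* A) {p : ℕ}
    (hp : P.index.Coprime p) (hpow : ∀ m (hm : m ∈ M), ψ ⟨m, hMP hm⟩ ^ p = 1)
    (hinv : ∀ h m (hm : m ∈ M), ψ ⟨h⁻¹ * m * h, hMP (Subgroup.Normal.conj_mem' ‹_› m hm h)⟩ =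
      ψ ⟨m, hMP hm⟩) :
    ∃ μ : H →* A, ∀ m (hm : m ∈ M), μ m = ψ ⟨m, hMP hm⟩ := by
  have htransfer (m) (hm : m ∈ M) : ψ.transfer m = ψ ⟨m, hMP hm⟩ ^ P.index := by
    let T : P.LeftTransversal := default
    rw [MonoidHom.transfer_def ψ T]
    have hfix (q : H ⧸ P) : m⁻¹ • q = q := by
      induction q using QuotientGroup.induction_on with
      | H h =>
        rw [MulAction.Quotient.smul_mk, QuotientGroup.eq, smul_eq_mul, _root_.mul_inv_rev, inv_inv]
        exact hMP (Subgroup.Normal.conj_mem' ‹_› m hm h)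
    let _ := P.fintypeQuotientOfFiniteIndex
    rw [Subgroup.leftTransversals.diff, Subgroup.index_eq_card, Nat.card_eq_fintype_card,
      ← Finset.card_univ]
    refine Finset.prod_eq_pow_card fun q _ => ?_
    rw [← hinv (T.2.leftQuotientEquiv q) m hm]
    congr 2
    rw [Subgroup.smul_apply_eq_smul_apply_inv_smul, hfix, smul_eq_mul, mul_assoc]
  obtain ⟨k, hk⟩ : ∃ k, P.index * k ≡ 1 [MOD p] := by
    rcases Nat.eq_zero_or_pos p with rfl | hpos
    · exact ⟨1, by simp [(Nat.coprime_zero_right _).1 hp, Nat.ModEq]⟩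
    · obtain ⟨k, hk⟩ := Nat.exists_mul_mod_eq_of_coprime 1 hp hpos.ne'
      exact ⟨k, hk.2⟩
  refine ⟨(powMonoidHom k).comp ψ.transfer, fun m hm => ?_⟩
  rw [MonoidHom.comp_apply, htransfer m hm, powMonoidHom_apply, ← pow_mul]
  conv_rhs => rw [← pow_one (ψ ⟨m, hMP hm⟩)]
  exact pow_eq_pow_of_modEq hk (hpow m hm)

namespace GroupExtension

variable {K G N Γ : Type*} [Field K] [Group G] [CommGroup N] [Group Γ]

/-- It suffices to extend a character of exponent `p` to the preimages of the `p`-subgroups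
stabilizing it. -/
theorem extendsToStabilizer_of_isPGroup [Finite G] (S : GroupExtension N Γ G) (φ : G →* MulAut N)
    (hφ : ∀ γ n, S.inl (φ (S.rightHom γ) n) = γ * S.inl n * γ⁻¹) (χ : N →* Kˣ)
    (p : ℕ) [Fact p.Prime] (hχ : ∀ n, χ n ^ p = 1)
    (hext : ∀ Q : Subgroup G, IsPGroup p Q → (∀ g ∈ Q, χ.comp (φ g).toMonoidHom = χ) →
      ∃ Λ : Γ → Kˣ, (∀ n, Λ (S.inl n) = χ n) ∧
        ∀ a b, S.rightHom a ∈ Q → S.rightHom b ∈ Q → Λ (a * b) = Λ a * Λ b) :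
    ExtendsToStabilizer S φ χ := by
  classical
  let L : Subgroup G :=
    { carrier := {g | χ.comp (φ g).toMonoidHom = χ}
      one_mem' := comp_map_one φ χ
      mul_mem' := fun {g h} hg hh => by
        change _ = _ at hg hh ⊢
        rw [comp_map_mul, hg, hh]
      inv_mem' := fun {g} hg => by
        change _ = _ at hg ⊢
        conv_lhs => rw [← hg]
        rw [← comp_map_mul, mul_inv_cancel, comp_map_one] }
  let Q : Sylow p L := default
  have hQ : IsPGroup p ((Q : Subgroup L).map L.subtype) := Q.isPGroup'.map _
  obtain ⟨Λ, hΛ, hmul⟩ := hext _ hQ (by rintro _ ⟨g, -, rfl⟩; exact g.2)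
  let H : Subgroup Γ := L.comap S.rightHom
  let f : H →* L := S.rightHom.subgroupComap L
  have hf : Function.Surjective f := S.rightHom.subgroupComap_surjective_of_surjective L
    S.rightHom_surjective
  let P : Subgroup H := (Q : Subgroup L).comap f
  have hidx : P.index = (Q : Subgroup L).index := Subgroup.index_comap_of_surjective _ hf
  have : P.FiniteIndex := ⟨hidx ▸ Subgroup.FiniteIndex.index_ne_zero⟩
  have hP (a : P) : S.rightHom (a : H) ∈ (Q : Subgroup L).map L.subtype := ⟨f a, a.2, rfl⟩
  let ψ : P →* Kˣ := MonoidHom.mk' (fun a => Λ (a : H)) fun a b => hmul _ _ (hP a) (hP b)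
  let M : Subgroup H := f.ker
  have hMP : M ≤ P := fun m hm => by
    change f m ∈ (Q : Subgroup L)
    rw [show f m = 1 from hm]
    exact one_mem _
  have hM (m : H) (hm : m ∈ M) : ∃ n, S.inl n = m := by
    have : (m : Γ) ∈ S.inl.range := by
      rw [S.range_inl_eq_ker_rightHom]
      exact congrArg Subtype.val (show f m = 1 from hm)
    exact this
  obtain ⟨μ, hμ⟩ := Subgroup.exists_extension_of_coprime_index M P hMP ψ (p := p)
    (hidx ▸ ((Nat.Prime.coprime_iff_not_dvd Fact.out).2 Q.not_dvd_index).symm)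
    (fun m hm => by
      obtain ⟨n, hn⟩ := hM m hm
      change Λ m ^ p = 1
      rw [← hn, hΛ, hχ])
    (fun h m hm => by
      obtain ⟨n, hn⟩ := hM m hm
      change Λ ((h : Γ)⁻¹ * m * h) = Λ m
      have h2 : (h : Γ)⁻¹ * S.inl n * h = S.inl (φ (S.rightHom (h : Γ)⁻¹) n) := by
        rw [hφ, inv_inv]
      rw [← hn, h2, hΛ, hΛ]
      exact DFunLike.congr_fun (show χ.comp (φ (S.rightHom (h⁻¹ : H))).toMonoidHom = χ
        from (h⁻¹).2) n)
  refine ⟨fun γ => if hγ : γ ∈ H then μ ⟨γ, hγ⟩ else 1, fun n => ?_, fun a b ha hb => ?_⟩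
  · have hn : S.inl n ∈ H := by
      change χ.comp (φ (S.rightHom (S.inl n))).toMonoidHom = χ
      rw [S.rightHom_inl, comp_map_one]
    simp only [hn, dif_pos]
    rw [hμ ⟨S.inl n, hn⟩ (Subtype.ext (S.rightHom_inl n))]
    exact hΛ n
  · have ha' : a ∈ H := ha
    have hb' : b ∈ H := hb
    have hab' : a * b ∈ H := mul_mem ha' hb'
    simp only [ha', hb', hab', dif_pos]
    exact map_mul μ ⟨a, ha'⟩ ⟨b, hb'⟩

end GroupExtension

section Unipotent

variable {k : Type*} [Field k]

/-- The space of coinvariants of a nonzero representation of a `p`-group in characteristic `p` is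
nonzero. -/
theorem IsPGroup.span_sub_ne_top {Q W : Type*} [Group Q] [Finite k] {p : ℕ} [Fact p.Prime]
    [CharP k p] (hQ : IsPGroup p Q) [AddCommGroup W] [Module k W] [Module.Finite k W]
    [Nontrivial W] (ρ : Representation k Q W) :
    Submodule.span k {x : W | ∃ u w, ρ u w - w = x} ≠ ⊤ := by
  intro htop
  let _ : MulAction Q (Module.Dual k W) :=
    { smul u f := ρ.dual u f
      one_smul f := by exact congrArg (· f) (map_one ρ.dual)
      mul_smul u v f := by exact congrArg (· f) (map_mul ρ.dual u v) }
  have : Finite (Module.Dual k W) := Module.finite_of_finite k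
  have hcard : p ∣ Nat.card (Module.Dual k W) := by
    rw [Module.natCard_eq_pow_finrank (K := k), Subspace.dual_finrank_eq]
    refine dvd_pow ?_ Module.finrank_pos.ne'
    have := Fintype.ofFinite k
    rw [Nat.card_eq_fintype_card]
    obtain ⟨n, -, hn⟩ := FiniteField.card k p
    exact hn ▸ dvd_pow_self p n.ne_zero
  obtain ⟨f, hf, hne⟩ := hQ.exists_fixed_point_of_prime_dvd_card_of_fixed_point
    (Module.Dual k W) hcard (a := 0) fun u => map_zero (ρ.dual u)
  refine hne (LinearMap.ext_on htop ?_)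
  rintro _ ⟨u, w, rfl⟩
  have h : f (ρ u w) = f w := by
    have h1 : ρ.dual u⁻¹ f = f := hf u⁻¹
    conv_rhs => rw [← h1]
    rw [Representation.dual_apply, inv_inv]
    rfl
  simp [h]

/-- The descending series of coinvariant submodules of a representation. -/
def Representation.coinvariantSeries {Q W : Type*} [Group Q] [AddCommGroup W] [Module k W]
    (ρ : Representation k Q W) : ℕ → Submodule k W
  | 0 => ⊤
  | i + 1 => Submodule.span k {x | ∃ u, ∃ w ∈ coinvariantSeries ρ i, ρ u w - w = x}

namespace Representation

variable {Q W : Type*} [Group Q] [AddCommGroup W] [Module k W] (ρ : Representation k Q W)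

theorem sub_mem_coinvariantSeries {i : ℕ} {w : W} (hw : w ∈ ρ.coinvariantSeries i) (u : Q) :
    ρ u w - w ∈ ρ.coinvariantSeries (i + 1) :=
  Submodule.subset_span ⟨u, w, hw, rfl⟩

theorem coinvariantSeries_succ_le_and_stable (i : ℕ) :
    ρ.coinvariantSeries (i + 1) ≤ ρ.coinvariantSeries i ∧
      ∀ u, ∀ w ∈ ρ.coinvariantSeries i, ρ u w ∈ ρ.coinvariantSeries i := by
  induction i with
  | zero => exact ⟨le_top, fun _ _ _ => Submodule.mem_top⟩
  | succ i ih =>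
    have hle : ρ.coinvariantSeries (i + 2) ≤ ρ.coinvariantSeries (i + 1) := by
      refine Submodule.span_le.2 ?_
      rintro _ ⟨u, w, hw, rfl⟩
      exact ρ.sub_mem_coinvariantSeries (ih.1 hw) u
    refine ⟨hle, fun u w hw => ?_⟩
    have := hle (ρ.sub_mem_coinvariantSeries hw u)
    simpa using add_mem this hw

theorem coinvariantSeries_antitone : Antitone ρ.coinvariantSeries :=
  antitone_nat_of_succ_le fun i => (ρ.coinvariantSeries_succ_le_and_stable i).1

theorem exists_coinvariantSeries_eq_bot [Finite k] {p : ℕ} [Fact p.Prime] [CharP k p]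
    (hQ : IsPGroup p Q) [Module.Finite k W] : ∃ r, ρ.coinvariantSeries r = ⊥ := by
  have hlt (i : ℕ) (hi : ρ.coinvariantSeries i ≠ ⊥) :
      ρ.coinvariantSeries (i + 1) < ρ.coinvariantSeries i := by
    refine lt_of_le_of_ne (ρ.coinvariantSeries_succ_le_and_stable i).1 fun heq => ?_
    have := Submodule.nontrivial_iff_ne_bot.2 hi
    refine hQ.span_sub_ne_top (ρ.subrepresentation (ρ.coinvariantSeries i)
      fun u w hw => (ρ.coinvariantSeries_succ_le_and_stable i).2 u w hw) ?_
    rw [eq_top_iff, ← Submodule.map_le_map_iff_of_injective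
      (ρ.coinvariantSeries i).injective_subtype, Submodule.map_subtype_top, Submodule.map_span]
    conv_lhs => rw [← heq]
    refine Submodule.span_le.2 ?_
    rintro _ ⟨u, w, hw, rfl⟩
    exact Submodule.subset_span ⟨_, ⟨u, ⟨w, hw⟩, rfl⟩, rfl⟩
  have hrank (i : ℕ) : ρ.coinvariantSeries i = ⊥ ∨
      Module.finrank k (ρ.coinvariantSeries i) + i ≤ Module.finrank k W := by
    induction i with
    | zero => exact Or.inr (Submodule.finrank_le _)
    | succ i ih =>
      rcases ih with h | h
      · exact Or.inl (eq_bot_iff.2 (h ▸ (ρ.coinvariantSeries_succ_le_and_stable i).1))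
      · by_cases hi : ρ.coinvariantSeries i = ⊥
        · exact Or.inl (eq_bot_iff.2 (hi ▸ (ρ.coinvariantSeries_succ_le_and_stable i).1))
        · have := Submodule.finrank_lt_finrank_of_lt (hlt i hi)
          exact Or.inr (by omega)
  refine ⟨Module.finrank k W + 1, (hrank _).resolve_right (by omega)⟩

end Representation

/-- A basis adapted to a descending filtration. -/
theorem Submodule.exists_basis_adapted {ι W : Type*} [AddCommGroup W] [Module k W]
    (b₀ : Module.Basis ι k W) {V : ℕ → Submodule k W} (hV : Antitone V) (h0 : V 0 = ⊤) {r : ℕ}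
    (hr : V r = ⊥) :
    ∃ (b : Module.Basis ι k W) (ℓ : ι → ℕ), (∀ i, b i ∈ V (ℓ i)) ∧
      ∀ i, ∀ v ∈ V (ℓ i + 1), b.repr v i = 0 := by
  classical
  have hB (j : ℕ) (hj : j ≤ r) : ∃ B : Set W, B ⊆ V (r - j) ∧ LinearIndepOn k id B ∧
      ∀ i, r - j ≤ i → V i ≤ Submodule.span k (B ∩ V i) := by
    induction j with
    | zero =>
      refine ⟨∅, Set.empty_subset _, linearIndepOn_empty _ _, fun i hi => ?_⟩
      have : V i ≤ ⊥ := hr ▸ hV (by simpa using hi)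
      exact this.trans bot_le
    | succ j ih =>
      obtain ⟨B, hBV, hBi, hBs⟩ := ih (by omega)
      obtain ⟨B', hB'V, hBB', hVB', hB'i⟩ := exists_linearIndepOn_id_extension hBi
        (hBV.trans (hV (by omega : r - (j + 1) ≤ r - j)))
      refine ⟨B', hB'V, hB'i, fun i hi => ?_⟩
      rcases hi.eq_or_lt with rfl | hi
      · rw [Set.inter_eq_left.2 hB'V]
        exact hVB'
      · exact (hBs i (by omega)).trans
          (Submodule.span_mono (Set.inter_subset_inter_left _ hBB'))
  obtain ⟨B, -, hBi, hBs⟩ := hB r le_rfl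
  simp only [Nat.sub_self, Nat.zero_le, forall_const] at hBs
  have htop : ⊤ ≤ Submodule.span k (Set.range ((↑) : B → W)) := by
    rw [Subtype.range_coe, ← h0]
    exact (hBs 0).trans (Submodule.span_mono Set.inter_subset_left)
  let b₁ : Module.Basis B k W := Module.Basis.mk hBi htop
  have hb₁ (x : B) : b₁ x = x := Module.Basis.mk_apply _ _ x
  have hlevel (x : B) : ∃ i, (x : W) ∈ V i ∧ (x : W) ∉ V (i + 1) := by
    have hex : ∃ i, (x : W) ∉ V i := ⟨r, by
      rw [hr, Submodule.mem_bot, ← hb₁]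
      exact b₁.ne_zero x⟩
    obtain ⟨i, hi⟩ : ∃ i, Nat.find hex = i + 1 := Nat.exists_eq_succ_of_ne_zero fun h => by
      have := Nat.find_spec hex
      rw [h, h0] at this
      exact this Submodule.mem_top
    exact ⟨i, not_not.1 (Nat.find_min hex (by omega)), hi ▸ Nat.find_spec hex⟩
  choose ℓ hℓ hℓ' using hlevel
  have hrepr (x : B) (v : W) (hv : v ∈ V (ℓ x + 1)) : b₁.repr v x = 0 := by
    have hv' := hBs _ hv
    induction hv' using Submodule.span_induction with
    | mem y hy =>
      have hne : (⟨y, hy.1⟩ : B) ≠ x := by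
        intro h
        exact hℓ' x (h ▸ hy.2)
      rw [show y = b₁ ⟨y, hy.1⟩ from (hb₁ ⟨y, hy.1⟩).symm, b₁.repr_self,
        Finsupp.single_eq_of_ne hne.symm]
    | zero => simp
    | add y z hy hz hy' hz' =>
      have h1 : y ∈ V (ℓ x + 1) := Submodule.span_le.2 Set.inter_subset_right hy
      have h2 : z ∈ V (ℓ x + 1) := Submodule.span_le.2 Set.inter_subset_right hz
      simp [hy' h1, hz' h2]
    | smul c y hy hy' =>
      have h1 : y ∈ V (ℓ x + 1) := Submodule.span_le.2 Set.inter_subset_right hy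
      simp [hy' h1]
  let e := b₁.indexEquiv b₀
  refine ⟨b₁.reindex e, ℓ ∘ e.symm, fun i => ?_, fun i v hv => ?_⟩
  · rw [Module.Basis.reindex_apply, hb₁]
    exact hℓ _
  · rw [Module.Basis.repr_reindex_apply]
    exact hrepr _ v hv

/-- A `p`-group of matrices in characteristic `p` is block unitriangular in a suitable basis, in
which additive characters invariant under the group are trivial on strictly block triangular
matrices. -/
theorem IsPGroup.exists_strictlyTriangular {Q ι A : Type*} [Group Q] [Finite k] {p : ℕ}
    [Fact p.Prime] [CharP k p] (hQ : IsPGroup p Q) [Fintype ι] [DecidableEq ι] [CommGroup A]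
    (ρ : Q →* Matrix ι ι k) (χ : AddChar (Matrix ι ι k) A)
    (hχ : ∀ u z, χ (ρ u * z) = χ (z * ρ u)) :
    ∃ (g g' : Matrix ι ι k) (ℓ : ι → ℕ), g * g' = 1 ∧ g' * g = 1 ∧
      (∀ u i j, ℓ i ≤ ℓ j → (g' * (ρ u - 1) * g) i j = 0) ∧
      ∀ y : Matrix ι ι k, (∀ i j, ℓ i ≤ ℓ j → y i j = 0) → χ (g * y * g') = 1 := by
  let σ : Representation k Q (ι → k) := (Matrix.toLinAlgEquiv' : _ ≃ₐ[k] _).toMonoidHom.comp ρ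
  have hσ (u : Q) (v : ι → k) : σ u v = ρ u *ᵥ v := Matrix.toLin'_apply _ _
  obtain ⟨r, hr⟩ := σ.exists_coinvariantSeries_eq_bot hQ
  obtain ⟨b, ℓ, hb, hbr⟩ := Submodule.exists_basis_adapted (Pi.basisFun k ι)
    σ.coinvariantSeries_antitone rfl hr
  have hrank (i : ℕ) : ∀ w ∈ σ.coinvariantSeries i, ∀ f : ι → k,
      (∀ v ∈ σ.coinvariantSeries i, f ⬝ᵥ v = 0) → χ (vecMulVec w f) = 1 := by
    induction i with
    | zero =>
      intro w _ f hf
      have : f = 0 := by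
        ext i
        simpa using hf (Pi.single i 1) Submodule.mem_top
      simp [this]
    | succ i ih =>
      intro w hw f hf
      induction hw using Submodule.span_induction generalizing f with
      | mem w hw =>
        obtain ⟨u, v, hv, rfl⟩ := hw
        have h1 : vecMulVec (σ u v - v) f = ρ u * vecMulVec v f - vecMulVec v f * ρ u
            + vecMulVec v (Matrix.vecMul f (ρ u) - f) := by
          rw [hσ, Matrix.mul_vecMulVec, Matrix.vecMulVec_mul, Matrix.sub_vecMulVec,
            Matrix.vecMulVec_sub]
          abel
        rw [h1, AddChar.map_add_eq_mul, AddChar.map_sub_eq_div, hχ, div_self', one_mul]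
        refine ih v hv _ fun x hx => ?_
        rw [sub_dotProduct, ← Matrix.dotProduct_mulVec, ← dotProduct_sub, ← hσ]
        exact hf _ (σ.sub_mem_coinvariantSeries hx u)
      | zero => simp
      | add w w' _ _ h h' => rw [Matrix.add_vecMulVec, AddChar.map_add_eq_mul, h f hf,
          h' f hf, one_mul]
      | smul c w _ h =>
        rw [Matrix.smul_vecMulVec, ← Matrix.vecMulVec_smul]
        exact h _ fun v hv => by rw [smul_dotProduct, hf v hv, smul_zero]
  let g : Matrix ι ι k := (Pi.basisFun k ι).toMatrix b
  let g' : Matrix ι ι k := b.toMatrix (Pi.basisFun k ι)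
  have hgg' : g * g' = 1 := Module.Basis.toMatrix_mul_toMatrix_flip _ _
  have hg'g : g' * g = 1 := Module.Basis.toMatrix_mul_toMatrix_flip _ _
  have hcol (j : ι) : g.col j = b j := by
    ext i
    simp [g, Module.Basis.toMatrix_apply]
  have hg' (v : ι → k) (i : ι) : (g' *ᵥ v) i = b.repr v i := by
    rw [← (Pi.basisFun k ι).toMatrix_mulVec_repr b v]
    rfl
  refine ⟨g, g', ℓ, hgg', hg'g, fun u i j hij => ?_, fun y hy => ?_⟩
  · have h1 : (g' * (ρ u - 1) * g) i j = b.repr (σ u (b j) - b j) i := by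
      rw [← hg', hσ, ← hcol]
      nth_rw 2 [← Matrix.one_mulVec (g.col j)]
      rw [← Matrix.sub_mulVec, Matrix.mulVec_mulVec]
      rfl
    rw [h1]
    exact hbr i _ (σ.coinvariantSeries_antitone (Nat.succ_le_succ hij)
      (σ.sub_mem_coinvariantSeries (hb j) u))
  · have h1 : g * y * g' = ∑ i, ∑ j, vecMulVec (y i j • b i) (g'.row j) := by
      ext a c
      simp only [Matrix.sum_apply, Matrix.mul_apply, vecMulVec_apply, Pi.smul_apply, ← hcol,
        Matrix.col_apply, Matrix.row_apply, Finset.sum_mul, smul_eq_mul]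
      rw [Finset.sum_comm]
      exact Finset.sum_congr rfl fun _ _ => Finset.sum_congr rfl fun _ _ => by ring
    have hsum (s : ι → Matrix ι ι k) (hs : ∀ i, χ (s i) = 1) : χ (∑ i, s i) = 1 := by
      refine Finset.sum_induction s (fun z => χ z = 1) (fun a b ha hb => ?_)
        χ.map_zero_eq_one fun i _ => hs i
      rw [AddChar.map_add_eq_mul, ha, hb, one_mul]
    rw [h1]
    refine hsum _ fun i => hsum _ fun j => ?_
    rcases le_or_gt (ℓ i) (ℓ j) with hij | hij
    · simp [hy i j hij]
    · refine hrank (ℓ j + 1) _ (Submodule.smul_mem _ _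
        (σ.coinvariantSeries_antitone hij (hb i))) _ fun v hv => ?_
      exact (hg' v j).trans (hbr j v hv)

end Unipotent

/-- A square-zero extension `R` of a ring `k` whose kernel is identified with `k` as an
`R`-module. -/
structure SquareZeroThickening (R k : Type*) [CommRing R] [CommRing k] where
  /-- The reduction map. -/
  red : R →+* k
  /-- The inclusion of the kernel. -/
  incl : k →+ R
  red_surjective : Function.Surjective red
  incl_injective : Function.Injective incl
  red_eq_zero_iff : ∀ r, red r = 0 ↔ ∃ x, incl x = r
  mul_incl : ∀ r x, r * incl x = incl (red r * x)

namespace Matrix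

section SymplecticAdjoint

variable {l R k : Type*} [Fintype l] [DecidableEq l] [CommRing R] [CommRing k]

/-- The adjoint of a matrix with respect to the standard symplectic form. -/
def symplecticAdjoint (M : Matrix (l ⊕ l) (l ⊕ l) R) : Matrix (l ⊕ l) (l ⊕ l) R :=
  -(J l R * Mᵀ * J l R)

theorem symplecticAdjoint_add (M M' : Matrix (l ⊕ l) (l ⊕ l) R) :
    symplecticAdjoint (M + M') = symplecticAdjoint M + symplecticAdjoint M' := by
  simp only [symplecticAdjoint, transpose_add, mul_add, add_mul, neg_add]

theorem symplecticAdjoint_zero :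
    symplecticAdjoint (0 : Matrix (l ⊕ l) (l ⊕ l) R) = 0 := by
  simp [symplecticAdjoint]

theorem symplecticAdjoint_neg (M : Matrix (l ⊕ l) (l ⊕ l) R) :
    symplecticAdjoint (-M) = -symplecticAdjoint M := by
  simp [symplecticAdjoint]

theorem symplecticAdjoint_one : symplecticAdjoint (1 : Matrix (l ⊕ l) (l ⊕ l) R) = 1 := by
  simp [symplecticAdjoint, J_squared]

theorem symplecticAdjoint_mul (M M' : Matrix (l ⊕ l) (l ⊕ l) R) :
    symplecticAdjoint (M * M') = symplecticAdjoint M' * symplecticAdjoint M := by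
  have : J l R * M'ᵀ * J l R * (J l R * Mᵀ * J l R)
      = J l R * M'ᵀ * (J l R * J l R) * Mᵀ * J l R := by simp only [mul_assoc]
  rw [symplecticAdjoint, symplecticAdjoint, symplecticAdjoint, neg_mul_neg, this, J_squared,
    transpose_mul]
  simp [mul_assoc]

theorem symplecticAdjoint_symplecticAdjoint (M : Matrix (l ⊕ l) (l ⊕ l) R) :
    symplecticAdjoint (symplecticAdjoint M) = M := by
  have : J l R * (J l R * (M * J l R)) * J l R
      = (J l R * J l R) * M * (J l R * J l R) := by simp only [mul_assoc]
  simp only [symplecticAdjoint, transpose_neg, transpose_mul, transpose_transpose, J_transpose,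
    neg_mul, mul_neg, neg_neg, this, J_squared, one_mul, mul_one]

theorem mem_symplecticGroup_iff_mul_symplecticAdjoint {A : Matrix (l ⊕ l) (l ⊕ l) R} :
    A ∈ symplecticGroup l R ↔ A * symplecticAdjoint A = 1 := by
  rw [SymplecticGroup.mem_iff, symplecticAdjoint]
  constructor
  · intro h
    rw [mul_neg, ← mul_assoc, ← mul_assoc, h, J_squared, neg_neg]
  · intro h
    have := congrArg (· * J l R) h
    simpa [mul_assoc, J_squared] using this

theorem coe_inv_symplecticGroup (A : symplecticGroup l R) :
    ((A⁻¹ : symplecticGroup l R) : Matrix (l ⊕ l) (l ⊕ l) R) =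
      symplecticAdjoint A.1 := by
  rw [SymplecticGroup.coe_inv, symplecticAdjoint]
  simp

theorem mul_symplecticAdjoint_of_mem (A : symplecticGroup l R) :
    (A : Matrix (l ⊕ l) (l ⊕ l) R) * symplecticAdjoint A.1 = 1 :=
  mem_symplecticGroup_iff_mul_symplecticAdjoint.1 A.2

theorem symplecticAdjoint_mul_of_mem (A : symplecticGroup l R) :
    symplecticAdjoint A.1 * (A : Matrix (l ⊕ l) (l ⊕ l) R) = 1 :=
  mul_eq_one_comm.1 (mul_symplecticAdjoint_of_mem A)

theorem symplecticAdjoint_map (f : R →+* k) (M : Matrix (l ⊕ l) (l ⊕ l) R) :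
    symplecticAdjoint (f.mapMatrix M) = f.mapMatrix (symplecticAdjoint M) := by
  have hJ : f.mapMatrix (J l R) = J l k := by
    ext (i | i) (j | j) <;> simp [J, Matrix.one_apply, apply_ite f]
  rw [symplecticAdjoint, symplecticAdjoint, map_neg, map_mul, map_mul, hJ]
  rfl

end SymplecticAdjoint

section Thickening

variable {l R k : Type*} [Fintype l] [DecidableEq l] [CommRing R] [CommRing k]
  (S : SquareZeroThickening R k)

theorem mapMatrix_incl_injective {ι : Type*} :
    Function.Injective (S.incl.mapMatrix (m := ι) (n := ι)) :=
  Matrix.map_injective S.incl_injective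

theorem mapMatrix_surjective {ι : Type*} [Fintype ι] [DecidableEq ι] :
    Function.Surjective (S.red.mapMatrix (m := ι)) := fun M => by
  choose f hf using S.red_surjective
  exact ⟨M.map f, by ext; simp [hf]⟩

variable {ι : Type*} [Fintype ι] [DecidableEq ι]

theorem exists_mapMatrix_incl {M : Matrix ι ι R} (h : S.red.mapMatrix M = 0) :
    ∃ y : Matrix ι ι k, S.incl.mapMatrix y = M := by
  have h' (i j) : ∃ x, S.incl x = M i j :=
    (S.red_eq_zero_iff _).1 (congrFun (congrFun h i) j)
  choose f hf using h'
  exact ⟨of f, by ext; simp [hf]⟩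

theorem mapMatrix_red_incl (y : Matrix ι ι k) : S.red.mapMatrix (S.incl.mapMatrix y) = 0 := by
  ext i j
  exact (S.red_eq_zero_iff _).2 ⟨_, rfl⟩

theorem mul_mapMatrix_incl (M : Matrix ι ι R) (y : Matrix ι ι k) :
    M * S.incl.mapMatrix y = S.incl.mapMatrix (S.red.mapMatrix M * y) := by
  ext i j
  simp [mul_apply, S.mul_incl]

theorem mapMatrix_incl_mul (y : Matrix ι ι k) (M : Matrix ι ι R) :
    S.incl.mapMatrix y * M = S.incl.mapMatrix (y * S.red.mapMatrix M) := by
  ext i j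
  simp [mul_apply, mul_comm _ (M _ _), mul_comm _ (S.red _), S.mul_incl]

theorem symplecticAdjoint_mapMatrix_incl (y : Matrix (l ⊕ l) (l ⊕ l) k) :
    symplecticAdjoint (S.incl.mapMatrix y) = S.incl.mapMatrix (symplecticAdjoint y) := by
  have hJ : S.red.mapMatrix (J l R) = J l k := by
    ext (i | i) (j | j) <;> simp [J, Matrix.one_apply, apply_ite S.red]
  rw [symplecticAdjoint, symplecticAdjoint, map_neg]
  change -(_ * S.incl.mapMatrix yᵀ * _) = _
  rw [mul_mapMatrix_incl, mapMatrix_incl_mul, hJ]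

end Thickening

end Matrix

namespace Matrix

section SymplecticExtension

variable (l : Type*) {R k : Type*} [Fintype l] [DecidableEq l] [CommRing R] [CommRing k]

/-- The symplectic Lie algebra, as the group of matrices that are skew for the symplectic
adjoint. -/
def symplecticSkew (k : Type*) [CommRing k] : AddSubgroup (Matrix (l ⊕ l) (l ⊕ l) k) where
  carrier := {y | y + symplecticAdjoint y = 0}
  zero_mem' := by simp [symplecticAdjoint_zero]
  add_mem' {y z} hy hz := by
    have : y + z + symplecticAdjoint (y + z)
        = (y + symplecticAdjoint y) + (z + symplecticAdjoint z) := by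
      rw [symplecticAdjoint_add]
      abel
    exact this.trans (by rw [hy, hz, add_zero])
  neg_mem' {y} hy := by
    have : -y + symplecticAdjoint (-y) = -(y + symplecticAdjoint y) := by
      rw [symplecticAdjoint_neg]
      abel
    exact this.trans (by rw [hy, neg_zero])

variable {l}

theorem mem_symplecticSkew {y : Matrix (l ⊕ l) (l ⊕ l) k} :
    y ∈ symplecticSkew l k ↔ y + symplecticAdjoint y = 0 := Iff.rfl

theorem conj_mem_symplecticSkew (g : symplecticGroup l k) {y : Matrix (l ⊕ l) (l ⊕ l) k}
    (hy : y ∈ symplecticSkew l k) :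
    g.1 * y * symplecticAdjoint g.1 ∈ symplecticSkew l k := by
  rw [mem_symplecticSkew] at hy ⊢
  rw [symplecticAdjoint_mul, symplecticAdjoint_mul, symplecticAdjoint_symplecticAdjoint,
    ← mul_assoc, ← add_mul, ← mul_add, hy, mul_zero, zero_mul]

variable (l k) in
/-- The adjoint action of the symplectic group on its Lie algebra. -/
def symplecticConj : symplecticGroup l k →* MulAut (Multiplicative (symplecticSkew l k)) where
  toFun g :=
    { toFun y := .ofAdd ⟨_, conj_mem_symplecticSkew g y.toAdd.2⟩
      invFun y := .ofAdd ⟨_, conj_mem_symplecticSkew g⁻¹ y.toAdd.2⟩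
      left_inv y := by
        refine congrArg Multiplicative.ofAdd (Subtype.ext ?_)
        simp only [toAdd_ofAdd, coe_inv_symplecticGroup, symplecticAdjoint_symplecticAdjoint]
        rw [mul_assoc, mul_assoc, symplecticAdjoint_mul_of_mem, mul_one, ← mul_assoc,
          symplecticAdjoint_mul_of_mem, one_mul]
        rfl
      right_inv y := by
        refine congrArg Multiplicative.ofAdd (Subtype.ext ?_)
        simp only [toAdd_ofAdd, coe_inv_symplecticGroup, symplecticAdjoint_symplecticAdjoint]
        rw [mul_assoc, mul_assoc, mul_symplecticAdjoint_of_mem, mul_one, ← mul_assoc,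
          mul_symplecticAdjoint_of_mem, one_mul]
        rfl
      map_mul' y z := by
        refine congrArg Multiplicative.ofAdd (Subtype.ext ?_)
        simp [mul_add, add_mul] }
  map_one' := by
    ext y
    simp [symplecticAdjoint_one]
  map_mul' g h := by
    ext y
    simp [symplecticAdjoint_mul, mul_assoc]

theorem coe_symplecticConj (g : symplecticGroup l k) (y : Multiplicative (symplecticSkew l k)) :
    ((symplecticConj l k g y).toAdd : Matrix (l ⊕ l) (l ⊕ l) k)
      = g.1 * y.toAdd.1 * symplecticAdjoint g.1 := rfl

variable (S : SquareZeroThickening R k)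

theorem one_add_incl_mem_symplecticGroup {y : Matrix (l ⊕ l) (l ⊕ l) k}
    (hy : y ∈ symplecticSkew l k) : 1 + S.incl.mapMatrix y ∈ symplecticGroup l R := by
  rw [mem_symplecticGroup_iff_mul_symplecticAdjoint, symplecticAdjoint_add, symplecticAdjoint_one,
    symplecticAdjoint_mapMatrix_incl, add_mul, one_mul, mul_add, mul_one, mul_mapMatrix_incl,
    mapMatrix_red_incl, zero_mul, map_zero, add_zero, add_assoc, ← map_add,
    add_comm (symplecticAdjoint y), mem_symplecticSkew.1 hy, map_zero, add_zero]

theorem map_mem_symplecticGroup (g : symplecticGroup l R) :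
    S.red.mapMatrix g.1 ∈ symplecticGroup l k := by
  rw [mem_symplecticGroup_iff_mul_symplecticAdjoint, symplecticAdjoint_map, ← map_mul,
    mul_symplecticAdjoint_of_mem, map_one]

theorem exists_mem_symplecticGroup_lift [Invertible (2 : k)] (g : symplecticGroup l k) :
    ∃ γ : symplecticGroup l R, S.red.mapMatrix γ.1 = g := by
  obtain ⟨m, hm⟩ := mapMatrix_surjective S g.1
  obtain ⟨E, hE⟩ := exists_mapMatrix_incl S (M := m * symplecticAdjoint m - 1) (by
    rw [map_sub, map_mul, ← symplecticAdjoint_map, hm, mul_symplecticAdjoint_of_mem, map_one,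
      sub_self])
  have hEm : m * symplecticAdjoint m = 1 + S.incl.mapMatrix E := by rw [hE]; abel
  have hEs : symplecticAdjoint E = E := by
    apply mapMatrix_incl_injective S
    rw [← symplecticAdjoint_mapMatrix_incl, hE, sub_eq_add_neg, symplecticAdjoint_add,
      symplecticAdjoint_neg, symplecticAdjoint_one, symplecticAdjoint_mul,
      symplecticAdjoint_symplecticAdjoint]
  set y : Matrix (l ⊕ l) (l ⊕ l) k := -(⅟2 : k) • E with hy
  have hys : symplecticAdjoint y = y := by
    conv_rhs => rw [hy, ← hEs]
    simp [hy, symplecticAdjoint]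
  have hyE : y + y + E = 0 := by
    rw [hy, ← add_smul, ← neg_add, ← two_mul, mul_invOf_self, neg_one_smul, neg_add_cancel]
  have hred : S.red.mapMatrix (1 + S.incl.mapMatrix y) = 1 := by
    rw [map_add, map_one, mapMatrix_red_incl, add_zero]
  refine ⟨⟨(1 + S.incl.mapMatrix y) * m, ?_⟩, ?_⟩
  · rw [mem_symplecticGroup_iff_mul_symplecticAdjoint, symplecticAdjoint_mul, mul_assoc,
      ← mul_assoc m, hEm, symplecticAdjoint_add, symplecticAdjoint_one,
      symplecticAdjoint_mapMatrix_incl, hys]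
    have h0 (a b : Matrix (l ⊕ l) (l ⊕ l) k) : S.incl.mapMatrix a * S.incl.mapMatrix b = 0 := by
      rw [mul_mapMatrix_incl, mapMatrix_red_incl, zero_mul, map_zero]
    have h1 : S.incl.mapMatrix y + S.incl.mapMatrix y + S.incl.mapMatrix E = 0 := by
      rw [← map_add, ← map_add, hyE, map_zero]
    simp only [add_mul, mul_add, one_mul, mul_one, h0, add_zero]
    rw [add_right_comm, add_assoc 1, add_assoc 1, h1, add_zero]
  · change S.red.mapMatrix ((1 + S.incl.mapMatrix y) * m) = _
    rw [map_mul, hred, one_mul, hm]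

/-- The symplectic group over a square-zero thickening, as an extension of the symplectic group
over the residue ring by its Lie algebra. -/
def symplecticExtension [Invertible (2 : k)] :
    GroupExtension (Multiplicative (symplecticSkew l k)) (symplecticGroup l R)
      (symplecticGroup l k) where
  inl :=
    { toFun y := ⟨_, one_add_incl_mem_symplecticGroup S y.toAdd.2⟩
      map_one' := by
        refine Subtype.ext ?_
        simp
      map_mul' y z := by
        refine Subtype.ext ?_
        change 1 + S.incl.mapMatrix (y.toAdd.1 + z.toAdd.1)
          = (1 + S.incl.mapMatrix y.toAdd.1) * (1 + S.incl.mapMatrix z.toAdd.1)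
        rw [add_mul, one_mul, mul_add, mul_one, mul_mapMatrix_incl, mapMatrix_red_incl, zero_mul,
          map_zero, add_zero, map_add]
        abel }
  rightHom :=
    { toFun g := ⟨_, map_mem_symplecticGroup S g⟩
      map_one' := Subtype.ext (map_one (S.red.mapMatrix (m := l ⊕ l)))
      map_mul' g h := Subtype.ext (map_mul S.red.mapMatrix g.1 h.1) }
  inl_injective y z h := by
    have h1 : 1 + S.incl.mapMatrix y.toAdd.1
        = 1 + S.incl.mapMatrix z.toAdd.1 := congrArg Subtype.val h
    exact Subtype.ext (mapMatrix_incl_injective S (add_left_cancel h1))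
  range_inl_eq_ker_rightHom := by
    ext g
    constructor
    · rintro ⟨y, rfl⟩
      refine Subtype.ext ?_
      change S.red.mapMatrix (1 + S.incl.mapMatrix y.toAdd.1) = 1
      rw [map_add, map_one, mapMatrix_red_incl, add_zero]
    · intro h
      have h1 : S.red.mapMatrix g.1 = 1 := congrArg Subtype.val h
      obtain ⟨y, hy⟩ := exists_mapMatrix_incl S (M := g.1 - 1) (by
        rw [map_sub, map_one, h1, sub_self])
      have hg : g.1 = 1 + S.incl.mapMatrix y := by rw [hy]; abel
      refine ⟨.ofAdd ⟨y, ?_⟩, Subtype.ext hg.symm⟩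
      have h2 := mul_symplecticAdjoint_of_mem g
      rw [hg, symplecticAdjoint_add, symplecticAdjoint_one, symplecticAdjoint_mapMatrix_incl,
        add_mul, one_mul, mul_add, mul_one, mul_mapMatrix_incl, mapMatrix_red_incl, zero_mul,
        map_zero, add_zero, add_assoc, ← map_add, add_eq_left] at h2
      rw [mem_symplecticSkew, add_comm]
      exact mapMatrix_incl_injective S (h2.trans (map_zero _).symm)
  rightHom_surjective g := by
    obtain ⟨γ, hγ⟩ := exists_mem_symplecticGroup_lift S g
    exact ⟨γ, Subtype.ext hγ⟩

theorem coe_symplecticExtension_inl [Invertible (2 : k)]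
    (y : Multiplicative (symplecticSkew l k)) :
    ((symplecticExtension S).inl y : Matrix (l ⊕ l) (l ⊕ l) R)
      = 1 + S.incl.mapMatrix y.toAdd.1 := rfl

theorem coe_symplecticExtension_rightHom [Invertible (2 : k)] (γ : symplecticGroup l R) :
    ((symplecticExtension S).rightHom γ : Matrix (l ⊕ l) (l ⊕ l) k)
      = S.red.mapMatrix γ.1 := rfl

theorem symplecticExtension_inl_conj [Invertible (2 : k)] (γ : symplecticGroup l R)
    (y : Multiplicative (symplecticSkew l k)) :
    (symplecticExtension S).inl (symplecticConj l k ((symplecticExtension S).rightHom γ) y)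
      = γ * (symplecticExtension S).inl y * γ⁻¹ := by
  refine Subtype.ext ?_
  rw [Submonoid.coe_mul, Submonoid.coe_mul, coe_inv_symplecticGroup, coe_symplecticExtension_inl,
    coe_symplecticExtension_inl, coe_symplecticConj, coe_symplecticExtension_rightHom, mul_add,
    mul_one, add_mul, mul_symplecticAdjoint_of_mem, mul_mapMatrix_incl, mapMatrix_incl_mul,
    symplecticAdjoint_map]

end SymplecticExtension

end Matrix

namespace Matrix

/-- Strictly block triangular matrices form a multiplicatively closed set. -/
theorem mul_apply_eq_zero_of_strictlyTriangular {ι R : Type*} [Fintype ι] [CommRing R] {ℓ : ι → ℕ}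
    {A B : Matrix ι ι R} (hA : ∀ i j, ℓ i ≤ ℓ j → A i j = 0)
    (hB : ∀ i j, ℓ i ≤ ℓ j → B i j = 0) (i j : ι) (hij : ℓ i ≤ ℓ j) : (A * B) i j = 0 := by
  rw [mul_apply]
  refine Finset.sum_eq_zero fun m _ => ?_
  rcases le_total (ℓ i) (ℓ m) with h | h
  · rw [hA i m h, zero_mul]
  · rw [hB m j (h.trans hij), mul_zero]

section Lift

variable {R k ι : Type*} [CommRing R] [Fintype ι] [DecidableEq ι]

theorem exists_inverse_lift [CommRing k] (S : SquareZeroThickening R k) {g g' : Matrix ι ι k}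
    (h : g * g' = 1) :
    ∃ m m' : Matrix ι ι R, S.red.mapMatrix m = g ∧ S.red.mapMatrix m' = g' ∧ m * m' = 1 ∧
      m' * m = 1 := by
  obtain ⟨m, hm⟩ := mapMatrix_surjective S g
  obtain ⟨m', hm'⟩ := mapMatrix_surjective S g'
  obtain ⟨E, hE⟩ := exists_mapMatrix_incl S (M := m * m' - 1) (by
    rw [map_sub, map_mul, hm, hm', h, map_one, sub_self])
  have hEm : m * m' = 1 + S.incl.mapMatrix E := by rw [hE]; abel
  have h1 : m * (m' * (1 - S.incl.mapMatrix E)) = 1 := by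
    rw [← mul_assoc, hEm, add_mul, one_mul, mul_sub, mul_one, mul_mapMatrix_incl,
      mapMatrix_red_incl, zero_mul, map_zero]
    abel
  refine ⟨m, m' * (1 - S.incl.mapMatrix E), hm, ?_, h1, mul_eq_one_comm.1 h1⟩
  rw [map_mul, map_sub, map_one, mapMatrix_red_incl, sub_zero, mul_one, hm']

/-- A `p`-group of matrices in characteristic `p` can be lifted along a square-zero thickening,
multiplicatively up to errors on which a given invariant character is trivial. -/
theorem _root_.IsPGroup.exists_lift {Q A : Type*} [Group Q] [Field k] [Finite k] {p : ℕ}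
    [Fact p.Prime] [CharP k p] (S : SquareZeroThickening R k) (hQ : IsPGroup p Q) [CommGroup A]
    (ρ : Q →* Matrix ι ι k) (χ : AddChar (Matrix ι ι k) A)
    (hχ : ∀ u z, χ (ρ u * z) = χ (z * ρ u)) :
    ∃ u : Q → Matrix ι ι R, u 1 = 1 ∧ (∀ a, S.red.mapMatrix (u a) = ρ a) ∧
      ∀ a b, ∃ z, u a * u b = u (a * b) + S.incl.mapMatrix z ∧ χ (z * ρ (a * b)⁻¹) = 1 := by
  obtain ⟨g, g', ℓ, hgg', hg'g, hρ, hℓ⟩ := hQ.exists_strictlyTriangular ρ χ hχ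
  obtain ⟨m, m', hm, hm', hmm', hm'm⟩ := exists_inverse_lift S hgg'
  obtain ⟨σ, hσ, hσ0⟩ : ∃ σ : k → R, (∀ x, S.red (σ x) = x) ∧ σ 0 = 0 := by
    choose f hf using S.red_surjective
    exact ⟨fun x => f x - f 0, fun x => by rw [map_sub, hf, hf, sub_zero], sub_self _⟩
  let s (a : Q) : Matrix ι ι k := g' * (ρ a - 1) * g
  let t (a : Q) : Matrix ι ι R := (s a).map σ
  have hs (a : Q) : ρ a = g * (1 + s a) * g' := by
    have : g * (g' * (ρ a - 1) * g) * g' = (g * g') * (ρ a - 1) * (g * g') := by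
      simp only [mul_assoc]
    rw [mul_add, mul_one, add_mul, this, hgg', one_mul, mul_one, add_sub_cancel]
  have hts (a : Q) : S.red.mapMatrix (t a) = s a := by
    ext i j
    exact hσ _
  have ht (a : Q) (i j : ι) (hij : ℓ i ≤ ℓ j) : t a i j = 0 := by
    change σ (s a i j) = 0
    rw [show s a i j = 0 from hρ a i j hij, hσ0]
  refine ⟨fun a => m * (1 + t a) * m', ?_, fun a => ?_, fun a b => ?_⟩
  · have : t 1 = 0 := by
      ext i j
      simp [t, s, hσ0]
    change m * (1 + t 1) * m' = 1
    rw [this, add_zero, mul_one, hmm']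
  · rw [map_mul, map_mul, map_add, map_one, hm, hm', hts, ← hs]
  · have hsab : (1 + s a) * (1 + s b) = 1 + s (a * b) := by
      have h1 (c : Q) : 1 + s c = g' * ρ c * g := by
        rw [show s c = g' * (ρ c - 1) * g from rfl, mul_sub, mul_one, sub_mul, hg'g,
          add_sub_cancel]
      have h2 : g' * ρ a * g * (g' * ρ b * g) = g' * (ρ a * (g * g') * ρ b) * g := by
        simp only [mul_assoc]
      rw [h1, h1, h1, h2, hgg', mul_one, map_mul]
    obtain ⟨y, hy⟩ := exists_mapMatrix_incl S (M := (1 + t a) * (1 + t b) - (1 + t (a * b))) (by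
      simp only [map_sub, map_mul, map_add, map_one, hts, hsab, sub_self])
    have hy0 (i j : ι) (hij : ℓ i ≤ ℓ j) : y i j = 0 := by
      apply S.incl_injective
      have h1 : (1 + t a) * (1 + t b) - (1 + t (a * b)) = t a + t b + t a * t b - t (a * b) := by
        noncomm_ring
      have h2 := congrFun (congrFun (hy.trans h1) i) j
      rw [map_zero]
      refine h2.trans ?_
      simp only [sub_apply, add_apply, ht _ i j hij,
        mul_apply_eq_zero_of_strictlyTriangular (ht a) (ht b) i j hij, add_zero, sub_zero]
    refine ⟨g * y * g', ?_, ?_⟩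
    · have h1 : m * (1 + t a) * m' * (m * (1 + t b) * m')
          = m * ((1 + t a) * (m' * m) * (1 + t b)) * m' := by simp only [mul_assoc]
      have h2 : (1 + t a) * (1 + t b) = 1 + t (a * b) + S.incl.mapMatrix y := by
        rw [hy]
        abel
      rw [h1, hm'm, mul_one, h2, mul_add m, add_mul, mul_mapMatrix_incl, mapMatrix_incl_mul, hm,
        hm']
    · have h1 (c : Q) : g * y * g' * ρ c = g * (y + y * s c) * g' := by
        have : g * y * g' * (g * (1 + s c) * g') = g * (y * (g' * g) * (1 + s c)) * g' := by
          simp only [mul_assoc]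
        rw [hs, this, hg'g, mul_one, mul_add, mul_one]
      rw [h1]
      refine hℓ _ fun i j hij => ?_
      rw [add_apply, hy0 i j hij, mul_apply_eq_zero_of_strictlyTriangular hy0 (hρ _) i j hij,
        add_zero]

end Lift

section ExtendCharacter

variable {l k : Type*} [Fintype l] [DecidableEq l] [CommRing k] [Invertible (2 : k)]

variable (l k) in
/-- The projection of a matrix to its skew part for the symplectic adjoint. -/
def symplecticSkewPart : Matrix (l ⊕ l) (l ⊕ l) k →+ symplecticSkew l k where
  toFun y := ⟨(⅟2 : k) • (y - symplecticAdjoint y), by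
    have h (c : k) (z : Matrix (l ⊕ l) (l ⊕ l) k) :
        symplecticAdjoint (c • z) = c • symplecticAdjoint z := by simp [symplecticAdjoint]
    rw [mem_symplecticSkew, h, ← smul_add, sub_eq_add_neg, symplecticAdjoint_add,
      symplecticAdjoint_neg, symplecticAdjoint_symplecticAdjoint]
    convert smul_zero (⅟2 : k) using 2
    abel⟩
  map_zero' := Subtype.ext (by simp [symplecticAdjoint_zero])
  map_add' y z := Subtype.ext (by
    simp only [symplecticAdjoint_add, AddSubgroup.coe_add, ← smul_add]
    congr 1
    abel)

theorem symplecticSkewPart_of_mem (y : symplecticSkew l k) :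
    symplecticSkewPart l k y.1 = y := by
  refine Subtype.ext ?_
  change (⅟2 : k) • (y.1 - symplecticAdjoint y.1) = y.1
  rw [← neg_eq_of_add_eq_zero_right (mem_symplecticSkew.1 y.2), sub_neg_eq_add, ← two_smul k y.1,
    smul_smul, invOf_mul_self, one_smul]

theorem symplecticSkewPart_conj (g : symplecticGroup l k) (y : Matrix (l ⊕ l) (l ⊕ l) k) :
    Multiplicative.ofAdd (symplecticSkewPart l k (g.1 * y * symplecticAdjoint g.1))
      = symplecticConj l k g (.ofAdd (symplecticSkewPart l k y)) := by
  refine congrArg Multiplicative.ofAdd (Subtype.ext ?_)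
  change (⅟2 : k) • (_ - symplecticAdjoint _)
    = g.1 * ((⅟2 : k) • (y - symplecticAdjoint y)) * symplecticAdjoint g.1
  rw [symplecticAdjoint_mul, symplecticAdjoint_mul, symplecticAdjoint_symplecticAdjoint,
    Matrix.mul_smul, Matrix.smul_mul, mul_sub, sub_mul, mul_assoc g.1 (symplecticAdjoint y)]

end ExtendCharacter

section ExtendsToStabilizer

variable {l R k K : Type*} [Fintype l] [DecidableEq l] [CommRing R] [Field k] [Finite k] [Field K]
  [Invertible (2 : k)]

/-- Every character of the kernel of reduction of a symplectic group along a square-zero thickening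
extends to the preimage of its stabilizer. -/
theorem symplecticExtension_extendsToStabilizer {p : ℕ} [Fact p.Prime] [CharP k p]
    (S : SquareZeroThickening R k) (χ : Multiplicative (symplecticSkew l k) →* Kˣ) :
    (symplecticExtension S).ExtendsToStabilizer (symplecticConj l k) χ := by
  refine GroupExtension.extendsToStabilizer_of_isPGroup _ _ (symplecticExtension_inl_conj S) χ p
    (fun y => ?_) fun Q hQ hfix => ?_
  · have : y ^ p = 1 := by
      refine congrArg Multiplicative.ofAdd (Subtype.ext ?_)
      change p • y.toAdd.1 = 0
      rw [← Nat.cast_smul_eq_nsmul k, CharP.cast_eq_zero, zero_smul]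
    rw [← map_pow, this, map_one]
  let ψ : AddChar (Matrix (l ⊕ l) (l ⊕ l) k) Kˣ :=
    { toFun y := χ (.ofAdd (symplecticSkewPart l k y))
      map_zero_eq_one' := by simp
      map_add_eq_mul' y z := by rw [map_add, ofAdd_add, map_mul] }
  let ρ : Q →* Matrix (l ⊕ l) (l ⊕ l) k := (symplecticGroup l k).subtype.comp Q.subtype
  have hρ (a : Q) : ρ a⁻¹ = symplecticAdjoint (ρ a) := coe_inv_symplecticGroup a.1
  have hρ' (a : Q) : ρ a⁻¹ * ρ a = 1 := by rw [← map_mul, inv_mul_cancel, map_one]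
  have hρ'' (a : Q) : ρ a * ρ a⁻¹ = 1 := by rw [← map_mul, mul_inv_cancel, map_one]
  have hψ (a : Q) (z : Matrix (l ⊕ l) (l ⊕ l) k) : ψ (ρ a * z) = ψ (z * ρ a) := by
    have h1 : ρ a * z = ρ a * (z * ρ a) * symplecticAdjoint (ρ a) := by
      rw [← hρ, mul_assoc, mul_assoc, hρ'', mul_one]
    have h2 := DFunLike.congr_fun (hfix a.1 a.2) (.ofAdd (symplecticSkewPart l k (z * ρ a)))
    rw [h1]
    exact (congrArg χ (symplecticSkewPart_conj a.1 (z * ρ a))).trans h2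
  obtain ⟨u, hu1, hu, humul⟩ := hQ.exists_lift S ρ ψ hψ
  have hΛ (γ : symplecticGroup l R) : ∃ c : Kˣ, ∀ (h : (symplecticExtension S).rightHom γ ∈ Q)
      (z : Matrix (l ⊕ l) (l ⊕ l) k), γ.1 = u ⟨_, h⟩ + S.incl.mapMatrix z →
        c = ψ (z * ρ ⟨_, h⟩⁻¹) := by
    by_cases h : (symplecticExtension S).rightHom γ ∈ Q
    · obtain ⟨z, hz⟩ := exists_mapMatrix_incl S (M := γ.1 - u ⟨_, h⟩) (by
        rw [map_sub, hu]
        exact sub_self _)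
      refine ⟨ψ (z * ρ ⟨_, h⟩⁻¹), fun _ z' hz' => ?_⟩
      rw [mapMatrix_incl_injective S (hz.trans (sub_eq_of_eq_add' hz'))]
    · exact ⟨1, fun h' => absurd h' h⟩
  choose Λ hΛ using hΛ
  refine ⟨Λ, fun y => ?_, fun a b ha hb => ?_⟩
  · have h1 : (symplecticExtension S).rightHom ((symplecticExtension S).inl y) = 1 :=
      (symplecticExtension S).rightHom_inl y
    have h2 : (⟨_, h1 ▸ Q.one_mem⟩ : Q) = 1 := Subtype.ext h1
    rw [hΛ _ (h1 ▸ Q.one_mem) y.toAdd.1 (by rw [h2, hu1]; rfl), h2, inv_one, map_one, mul_one]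
    exact congrArg χ (congrArg Multiplicative.ofAdd (symplecticSkewPart_of_mem y.toAdd))
  · have hex (γ : symplecticGroup l R) (h : (symplecticExtension S).rightHom γ ∈ Q) :
        ∃ z, γ.1 = u ⟨_, h⟩ + S.incl.mapMatrix z := by
      obtain ⟨z, hz⟩ := exists_mapMatrix_incl S (M := γ.1 - u ⟨_, h⟩) (by
        rw [map_sub, hu]
        exact sub_self _)
      exact ⟨z, by rw [hz, add_sub_cancel]⟩
    obtain ⟨z, hz⟩ := hex a ha
    obtain ⟨w, hw⟩ := hex b hb
    have hab : (symplecticExtension S).rightHom (a * b) ∈ Q := by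
      rw [map_mul]
      exact Q.mul_mem ha hb
    set α : Q := ⟨_, ha⟩ with hα
    set β : Q := ⟨_, hb⟩ with hβ
    have hαβ : (⟨_, hab⟩ : Q) = α * β := Subtype.ext (map_mul _ _ _)
    obtain ⟨y, hy, hψy⟩ := humul α β
    have h1 : (a * b).1 = u ⟨_, hab⟩ + S.incl.mapMatrix (y + ρ α * w + z * ρ β) := by
      rw [Submonoid.coe_mul, hz, hw, add_mul, mul_add, mul_add, hy, mul_mapMatrix_incl,
        mul_mapMatrix_incl, mapMatrix_red_incl, zero_mul, map_zero, add_zero, mapMatrix_incl_mul,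
        hu, hu, hαβ, map_add, map_add]
      abel
    have h2 : ρ (α * β)⁻¹ = ρ β⁻¹ * ρ α⁻¹ := by rw [_root_.mul_inv_rev, map_mul]
    have h3 : ρ α * w * ρ (α * β)⁻¹ = ρ α * (w * ρ β⁻¹ * ρ α⁻¹) := by
      rw [h2]
      simp only [mul_assoc]
    have h4 : z * ρ β * ρ (α * β)⁻¹ = z * ρ α⁻¹ := by
      rw [h2, mul_assoc, ← mul_assoc (ρ β), hρ'', one_mul]
    rw [hΛ _ hab _ h1, hΛ a ha z hz, hΛ b hb w hw, hαβ, add_mul, add_mul, AddChar.map_add_eq_mul,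
      AddChar.map_add_eq_mul, hψy, one_mul, h3, h4, hψ, mul_assoc _ (ρ α⁻¹), hρ', mul_one,
      mul_comm]

end ExtendsToStabilizer

end Matrix

namespace SquareZeroThickening

/-- The square-zero thickening of the quotient by a principal ideal that is its own annihilator. -/
noncomputable def ofGenerator {R k : Type*} [CommRing R] [CommRing k] (red : R →+* k)
    (hred : Function.Surjective red) (π : R) (hπ : ∀ r, red r = 0 ↔ ∃ s, r = π * s)
    (hann : ∀ r, π * r = 0 ↔ red r = 0) : SquareZeroThickening R k :=
  have key (r s : R) (h : red r = red s) : π * r = π * s := by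
    rw [← sub_eq_zero, ← mul_sub, hann, map_sub, h, sub_self]
  { red := red
    incl :=
      { toFun x := π * Function.surjInv hred x
        map_zero' := by rw [hann, Function.surjInv_eq hred]
        map_add' x y := by
          rw [← mul_add]
          exact key _ _ (by simp only [map_add, Function.surjInv_eq hred]) }
    red_surjective := hred
    incl_injective := by
      rw [injective_iff_map_eq_zero]
      intro x hx
      rwa [AddMonoidHom.coe_mk, ZeroHom.coe_mk, hann, Function.surjInv_eq hred] at hx
    red_eq_zero_iff r := by
      rw [hπ]
      constructor
      · rintro ⟨s, rfl⟩
        exact ⟨red s, key _ _ (Function.surjInv_eq hred _)⟩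
      · rintro ⟨x, rfl⟩
        exact ⟨_, rfl⟩
    mul_incl r x := by
      change r * (π * _) = π * _
      rw [mul_left_comm]
      exact key _ _ (by simp only [map_mul, Function.surjInv_eq hred]) }

/-- The dual numbers as a square-zero thickening. -/
def dualNumber (k : Type*) [CommRing k] : SquareZeroThickening (DualNumber k) k where
  red := (TrivSqZeroExt.fstHom k k k).toRingHom
  incl := TrivSqZeroExt.inrHom k k
  red_surjective x := ⟨TrivSqZeroExt.inl x, rfl⟩
  incl_injective := TrivSqZeroExt.inr_injective
  red_eq_zero_iff r :=
    ⟨fun h => ⟨r.snd, TrivSqZeroExt.ext h.symm rfl⟩, by rintro ⟨x, rfl⟩; rfl⟩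
  mul_incl r x := by
    ext <;> simp [mul_comm]

/-- The ring of Witt vectors of length two over a perfect field as a square-zero thickening. -/
noncomputable def wittVector (p : ℕ) [Fact p.Prime] (k : Type*) [Field k] [CharP k p]
    [PerfectRing k p] : SquareZeroThickening (TruncatedWittVector p 2 k) k :=
  have hsurj := WittVector.truncate_surjective (p := p) 2 k
  ofGenerator
    { toFun x := x.coeff 0
      map_one' := by
        rw [← map_one (WittVector.truncate (p := p) (R := k) 2), WittVector.coeff_truncate]
        exact map_one (WittVector.constantCoeff (p := p) (R := k))
      map_zero' := TruncatedWittVector.coeff_zero p 2 k 0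
      map_add' x y := by
        obtain ⟨x, rfl⟩ := hsurj x
        obtain ⟨y, rfl⟩ := hsurj y
        rw [← map_add]
        simp only [WittVector.coeff_truncate]
        exact map_add WittVector.constantCoeff x y
      map_mul' x y := by
        obtain ⟨x, rfl⟩ := hsurj x
        obtain ⟨y, rfl⟩ := hsurj y
        rw [← map_mul]
        simp only [WittVector.coeff_truncate]
        exact map_mul WittVector.constantCoeff x y }
    (fun x => ⟨TruncatedWittVector.mk p fun _ => x, rfl⟩) p
    (fun r => by
      obtain ⟨x, rfl⟩ := hsurj r
      change (WittVector.truncate 2 x).coeff 0 = 0 ↔ _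
      rw [WittVector.coeff_truncate]
      constructor
      · intro h
        obtain ⟨z, hz⟩ := (WittVector.frobenius_bijective p k).2 (x.shift 1)
        refine ⟨WittVector.truncate 2 z, ?_⟩
        rw [mul_comm, ← map_natCast (WittVector.truncate (p := p) (R := k) 2), ← map_mul,
          ← WittVector.verschiebung_frobenius, hz]
        congr 1
        have hx : x.shift 0 = x := WittVector.ext fun i => by simp [WittVector.shift_coeff]
        exact hx.symm.trans (WittVector.verschiebung_shift x 0 (by simpa using h)).symm
      · rintro ⟨s, hs⟩
        obtain ⟨z, rfl⟩ := hsurj s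
        rw [mul_comm, ← map_natCast (WittVector.truncate (p := p) (R := k) 2), ← map_mul] at hs
        have := congrArg (TruncatedWittVector.coeff 0) hs
        rw [WittVector.coeff_truncate, WittVector.coeff_truncate] at this
        exact this.trans (WittVector.mul_charP_coeff_zero z))
    (fun r => by
      obtain ⟨x, rfl⟩ := hsurj r
      change _ ↔ (WittVector.truncate 2 x).coeff 0 = 0
      rw [mul_comm, ← map_natCast (WittVector.truncate (p := p) (R := k) 2), ← map_mul,
        WittVector.coeff_truncate, ← RingHom.mem_ker, WittVector.mem_ker_truncate]
      constructor
      · intro h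
        have := h 1 one_lt_two
        rw [WittVector.mul_charP_coeff_succ] at this
        exact eq_zero_of_pow_eq_zero this
      · intro h i hi
        interval_cases i
        · exact WittVector.mul_charP_coeff_zero x
        · rw [WittVector.mul_charP_coeff_succ]
          exact (congrArg (· ^ p) h).trans (zero_pow (Fact.out : p.Prime).ne_zero))

end SquareZeroThickening

/-- Square-zero thickenings of a finite field of odd characteristic have symplectic groups with
isomorphic group algebras. -/
theorem Matrix.nonempty_groupAlgebra_symplecticGroup_algEquiv {l R R' k K : Type*} [Fintype l]
    [DecidableEq l] [CommRing R] [CommRing R'] [Field k] [Finite k] [Field K] [IsAlgClosed K]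
    {p : ℕ} [Fact p.Prime] [CharP k p] (hp : Odd p) (hK : (p : K) ≠ 0)
    (S : SquareZeroThickening R k) (S' : SquareZeroThickening R' k) :
    Nonempty (MonoidAlgebra K (symplecticGroup l R) ≃ₐ[K]
      MonoidAlgebra K (symplecticGroup l R')) := by
  have h2 : (2 : k) ≠ 0 := fun h => by
    have h2 : p ∣ 2 := (CharP.cast_eq_zero_iff k p 2).1 (by exact_mod_cast h)
    rw [(Nat.prime_dvd_prime_iff_eq Fact.out Nat.prime_two).1 h2] at hp
    exact absurd hp (by decide)
  have := invertibleOfNonzero h2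
  have : NeZero (p : K) := ⟨hK⟩
  have : HasEnoughRootsOfUnity K (Monoid.exponent (Multiplicative (symplecticSkew l k))) := by
    refine HasEnoughRootsOfUnity.of_dvd K (n := p)
      (Monoid.exponent_dvd_of_forall_pow_eq_one fun y => ?_)
    refine congrArg Multiplicative.ofAdd (Subtype.ext ?_)
    change p • y.toAdd.1 = 0
    rw [← Nat.cast_smul_eq_nsmul k, CharP.cast_eq_zero, zero_smul]
  exact GroupExtension.nonempty_groupAlgebra_algEquiv (symplecticExtension S)
    (symplecticExtension S') (symplecticConj l k) (symplecticExtension_inl_conj S)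
    (symplecticExtension_inl_conj S') (symplecticExtension_extendsToStabilizer S)
    (symplecticExtension_extendsToStabilizer S')

/-- **Theorem 5.4 for `Sp₂ₙ`.** For `p` an odd prime, `q = p ^ d`, and `K` algebraically
closed with `char K ≠ p`, the group algebras `K[Sp₂ₙ(𝔽_q[t]/t²)]` and `K[Sp₂ₙ(W₂(𝔽_q))]`
are isomorphic as `K`-algebras. -/
theorem group_algebra_iso_Sp_dualNumber_wittVector
    (p d n : ℕ) [Fact p.Prime] (hodd : Odd p) (hd : 1 ≤ d) (hn : 1 ≤ n)
    (q : ℕ) (hq : q = p ^ d)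
    (K : Type*) [Field K] [IsAlgClosed K] (hK : ringChar K ≠ p) :
    Nonempty
      (MonoidAlgebra K (Matrix.symplecticGroup (Fin n) (DualNumber (GaloisField p d))) ≃ₐ[K]
       MonoidAlgebra K
         (Matrix.symplecticGroup (Fin n) (TruncatedWittVector p 2 (GaloisField p d)))) := by
  have hp : (p : K) ≠ 0 := fun h =>
    ((Nat.dvd_prime Fact.out).1 ((ringChar.spec K p).1 h)).elim (CharP.ringChar_ne_one) hK
  exact Matrix.nonempty_groupAlgebra_symplecticGroup_algEquiv hodd hp
    (SquareZeroThickening.dualNumber _) (SquareZeroThickening.wittVector p _)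
end

section
/- Let p be a prime, d ≥ 1, q = p^d, n ≥ 1, and let K be an algebraically closed field with char K ≠ p. Let G = GL_n(DualNumber 𝔽_q) and G' = GL_n(TruncatedWittVector p 2 𝔽_q), where 𝔽_q = GaloisField p d. Then there exists a bijection Φ from the set of blocks of the group algebra K[G] to the set of blocks of K[G'] such that for every block b of K[G], the block algebras b·K[G] and Φ(b)·K[G'] are isomorphic as K-algebras (with identity elements b and Φ(b) respectively). -/
open Matrix

/-- A block of a group algebra `K[G]`: a primitive idempotent of the center, i.e. a nonzero
central idempotent `b` such that whenever `b = b₁ + b₂` with `b₁, b₂` central idempotents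
and `b₁ * b₂ = 0`, one of `b₁`, `b₂` is zero. -/
def IsBlock (K : Type*) [Field K] (G : Type*) [Group G] (b : MonoidAlgebra K G) : Prop :=
  b ≠ 0 ∧ b ∈ Subalgebra.center K (MonoidAlgebra K G) ∧ IsIdempotentElem b ∧
    ∀ b₁ b₂ : MonoidAlgebra K G,
      b₁ ∈ Subalgebra.center K (MonoidAlgebra K G) →
      b₂ ∈ Subalgebra.center K (MonoidAlgebra K G) →
      IsIdempotentElem b₁ → IsIdempotentElem b₂ →
      b = b₁ + b₂ → b₁ * b₂ = 0 → b₁ = 0 ∨ b₂ = 0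

/-- The block algebra `b·K[G]` attached to a central idempotent `b`, realized as the
non-unital subalgebra `{x | b * x = x}` of `K[G]`; its multiplicative identity is `b`. -/
def blockAlgebra (K : Type*) [Field K] (G : Type*) [Group G] (b : MonoidAlgebra K G)
    (hb : b ∈ Subalgebra.center K (MonoidAlgebra K G)) :
    NonUnitalSubalgebra K (MonoidAlgebra K G) where
  carrier := {x | b * x = x}
  add_mem' := by
    intro x y hx hy
    simp only [Set.mem_setOf_eq] at *
    rw [mul_add, hx, hy]
  zero_mem' := mul_zero b
  mul_mem' := by
    intro x y hx hy
    simp only [Set.mem_setOf_eq] at *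
    rw [← mul_assoc, hx]
  smul_mem' := by
    intro c x hx
    simp only [Set.mem_setOf_eq] at *
    rw [mul_smul_comm, hx]

/-- A presentation of a commutative ring `R` as a square-zero extension of the field `k` by `k`:
the residue map `π : R → k` and an additive isomorphism `ε` of `k` onto `ker π`
which is linear over `π`. -/
structure LengthTwo (R k : Type*) [CommRing R] [Field k] where
  π : R →+* k
  ε : k →+ R
  surjective : Function.Surjective π
  injective : Function.Injective ε
  π_ε : ∀ x, π (ε x) = 0
  exists_ε : ∀ r, π r = 0 → ∃ x, ε x = r
  mul_ε : ∀ r x, r * ε x = ε (π r * x)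

namespace LengthTwo

variable {R k : Type*} [CommRing R] [Field k] (D : LengthTwo R k)
variable {n : Type*}

theorem ε_mul_ε (x y : k) : D.ε x * D.ε y = 0 := by
  rw [D.mul_ε, D.π_ε, zero_mul, map_zero]

theorem isUnit_of_π_ne_zero {r : R} (hr : D.π r ≠ 0) : IsUnit r := by
  obtain ⟨s, hs⟩ := D.surjective (D.π r)⁻¹
  obtain ⟨x, hx⟩ := D.exists_ε (r * s - 1) (by simp [hs, hr])
  refine IsUnit.of_mul_eq_one (s * (1 - D.ε x)) ?_
  have h : r * s = 1 + D.ε x := by rw [hx]; ring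
  rw [← mul_assoc, h]
  linear_combination (-1 : R) * D.ε_mul_ε x x

/-- The matrix over `R` obtained by applying `ε` entrywise. -/
def mat (X : Matrix n n k) : Matrix n n R := X.map D.ε

@[simp]
theorem mat_apply (X : Matrix n n k) (i j : n) : D.mat X i j = D.ε (X i j) := rfl

theorem mat_add (X Y : Matrix n n k) : D.mat (X + Y) = D.mat X + D.mat Y := by
  ext; simp

@[simp]
theorem mat_map_π (X : Matrix n n k) : (D.mat X).map D.π = 0 := by
  ext; simp [D.π_ε]

theorem exists_mat (M : Matrix n n R) (hM : M.map D.π = 0) : ∃ X, D.mat X = M := by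
  choose X hX using fun i j => D.exists_ε (M i j) (congrFun (congrFun hM i) j)
  exact ⟨Matrix.of X, Matrix.ext hX⟩

variable [Fintype n]

theorem mul_mat (M : Matrix n n R) (X : Matrix n n k) :
    M * D.mat X = D.mat (M.map D.π * X) := by
  ext i j
  simp [Matrix.mul_apply, D.mul_ε]

theorem mat_mul (X : Matrix n n k) (M : Matrix n n R) :
    D.mat X * M = D.mat (X * M.map D.π) := by
  ext i j
  simp [Matrix.mul_apply, mul_comm _ (M _ _), D.mul_ε, mul_comm (D.π _)]

theorem mat_mul_mat (X Y : Matrix n n k) : D.mat X * D.mat Y = 0 := by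
  rw [D.mul_mat, D.mat_map_π, zero_mul]
  ext; simp

variable [DecidableEq n]

theorem det_one_add_mat (X : Matrix n n k) : (1 + D.mat X).det = 1 + D.ε X.trace := by
  choose s hs using D.surjective
  have h : ∀ x, D.ε x = D.ε 1 * s x := fun x => by rw [mul_comm, D.mul_ε, hs, mul_one]
  have hX : D.mat X = D.ε 1 • X.map s := by
    ext i j
    simp [h (X i j)]
  rw [hX, Matrix.det_one_add_smul, pow_two, D.ε_mul_ε, mul_zero, add_zero, mul_comm, Matrix.trace,
    Matrix.trace, map_sum, Finset.mul_sum]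
  simp [← h]

/-- Reduction of invertible matrices. -/
def red : GL n R →* GL n k := Matrix.GeneralLinearGroup.map D.π

@[simp]
theorem coe_red (g : GL n R) : (D.red g : Matrix n n k) = (g : Matrix n n R).map D.π := rfl

/-- The element `1 + ε X` of the congruence kernel. -/
def unip (X : Matrix n n k) : GL n R where
  val := 1 + D.mat X
  inv := 1 - D.mat X
  val_inv := by simp [add_mul, mul_sub, D.mat_mul_mat]
  inv_val := by simp [mul_add, sub_mul, D.mat_mul_mat]

@[simp]
theorem coe_unip (X : Matrix n n k) : (D.unip X : Matrix n n R) = 1 + D.mat X := rfl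

theorem unip_add (X Y : Matrix n n k) : D.unip (X + Y) = D.unip X * D.unip Y := by
  ext1
  simp only [coe_unip, Units.val_mul, D.mat_add, add_mul, mul_add, one_mul, mul_one, D.mat_mul_mat]
  abel

@[simp]
theorem unip_zero : D.unip (0 : Matrix n n k) = 1 := by
  ext; simp

@[simp]
theorem red_unip (X : Matrix n n k) : D.red (D.unip X) = 1 := by
  ext i j
  by_cases h : i = j <;> simp [D.π_ε, h]

theorem mul_unip (g : GL n R) (X : Matrix n n k) :
    g * D.unip X = D.unip ((D.red g).val * X * (D.red g)⁻¹.val) * g := by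
  ext1
  simp only [Units.val_mul, coe_unip, mul_add, add_mul, mul_one, one_mul, D.mul_mat, D.mat_mul,
    ← coe_red]
  rw [mul_assoc, ← Units.val_mul, inv_mul_cancel, Units.val_one, mul_one]

theorem exists_unip {g h : GL n R} (e : D.red g = D.red h) : ∃ X, h = g * D.unip X := by
  obtain ⟨X, hX⟩ := D.exists_mat ((g⁻¹ * h : GL n R).val - 1) (by
    have h1 : D.red (g⁻¹ * h) = 1 := by rw [map_mul, map_inv, e, inv_mul_cancel]
    have h2 := congrArg Units.val h1
    rw [coe_red, Units.val_one] at h2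
    rw [Matrix.map_sub _ (map_sub D.π), h2, Matrix.map_one _ (map_zero _) (map_one _), sub_self])
  refine ⟨X, ?_⟩
  have : D.unip X = g⁻¹ * h := by
    ext1
    simp [hX]
  rw [this, mul_inv_cancel_left]

/-- Entrywise lifts of invertible matrices are invertible. -/
theorem exists_lift (g : GL n k) (s : k → R) (hs : ∀ x, D.π (s x) = x) :
    ∃ h : GL n R, h.val = g.val.map s ∧ D.red h = g := by
  have hm : (g.val.map s).map D.π = g.val := by ext; simp [hs]
  have hu : IsUnit (g.val.map s).det := by
    apply D.isUnit_of_π_ne_zero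
    rw [RingHom.map_det, RingHom.mapMatrix_apply, hm]
    exact ((Matrix.isUnit_iff_isUnit_det _).1 g.isUnit).ne_zero
  exact ⟨Matrix.GeneralLinearGroup.mk'' _ hu, rfl, Units.ext hm⟩

theorem red_surjective : Function.Surjective (D.red : GL n R → GL n k) := fun g => by
  choose s hs using D.surjective
  obtain ⟨h, -, hh⟩ := D.exists_lift g s hs
  exact ⟨h, hh⟩

end LengthTwo

namespace LengthTwo

section

variable {n F K : Type*} [Fintype n] [DecidableEq n] [Field F] [Field K]

/-- Conjugation of matrices by invertible matrices. -/
def conjMat (g : GL n F) (A : Matrix n n F) : Matrix n n F := g.val * A * g⁻¹.val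

theorem conjMat_mul (g h : GL n F) (A : Matrix n n F) :
    conjMat (g * h) A = conjMat g (conjMat h A) := by
  simp only [conjMat, _root_.mul_inv_rev, Units.val_mul, mul_assoc]

@[simp]
theorem conjMat_one (A : Matrix n n F) : conjMat 1 A = A := by simp [conjMat]

@[simp]
theorem conjMat_inv_conjMat (g : GL n F) (A : Matrix n n F) : conjMat g⁻¹ (conjMat g A) = A := by
  rw [← conjMat_mul, inv_mul_cancel, conjMat_one]

@[simp]
theorem conjMat_conjMat_inv (g : GL n F) (A : Matrix n n F) : conjMat g (conjMat g⁻¹ A) = A := by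
  rw [← conjMat_mul, mul_inv_cancel, conjMat_one]

theorem conjMat_eq_iff_commute {g : GL n F} {A : Matrix n n F} :
    conjMat g A = A ↔ Commute g.val A := by
  rw [conjMat, Units.mul_inv_eq_iff_eq_mul]
  rfl

theorem conjMat_mul_conjMat (g : GL n F) (A B : Matrix n n F) :
    conjMat g A * conjMat g B = conjMat g (A * B) := by
  simp only [conjMat, mul_assoc, Units.inv_mul_cancel_left]

@[simp]
theorem trace_conjMat (g : GL n F) (A : Matrix n n F) : (conjMat g A).trace = A.trace := by
  rw [conjMat, Matrix.trace_mul_comm, Units.inv_mul_cancel_left]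

theorem trace_conjMat_mul (g : GL n F) (A X : Matrix n n F) :
    (conjMat g A * X).trace = (A * conjMat g⁻¹ X).trace := by
  rw [← trace_conjMat g (A * _), ← conjMat_mul_conjMat, conjMat_conjMat_inv]

theorem sum_addChar_trace_mul [Fintype F] [DecidableEq F] {ψ : AddChar F Kˣ}
    (hψ : ψ ≠ 1) (A : Matrix n n F) :
    ∑ X : Matrix n n F, (ψ (A * X).trace : K) =
      if A = 0 then (Fintype.card (Matrix n n F) : K) else 0 := by
  split_ifs with h
  · simp [h]
  obtain ⟨i, j, hij⟩ : ∃ i j, A i j ≠ 0 := by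
    by_contra! h'
    exact h (Matrix.ext h')
  let φ : AddChar (Matrix n n F) K :=
    ⟨fun X => ψ (A * X).trace, by simp, fun X Y => by simp [mul_add, AddChar.map_add_eq_mul]⟩
  refine AddChar.sum_eq_zero_of_ne_one (ψ := φ) fun hφ => hψ ?_
  ext x
  have := DFunLike.congr_fun hφ (Matrix.single j i ((A i j)⁻¹ * x))
  simpa [φ, Matrix.trace_mul_comm A, Matrix.trace_single_mul, hij, mul_comm _ x] using this

theorem card_matrix_ne_zero {F : Type*} [Fintype F] [Fintype (Matrix n n F)]
    (hF : (Fintype.card F : K) ≠ 0) : (Fintype.card (Matrix n n F) : K) ≠ 0 := by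
  rw [Fintype.card_congr (Matrix.of (m := n) (n := n) (α := F)).symm, Fintype.card_fun,
    Fintype.card_fun]
  exact_mod_cast pow_ne_zero _ (pow_ne_zero _ hF)

end

variable {R R' F K n : Type*} [CommRing R] [CommRing R'] [Field F] [Field K]
  [Fintype n] [DecidableEq n] [Fintype F]

open MonoidAlgebra in
/-- The idempotent of the group algebra attached to the character `1 + ε X ↦ ψ (tr (A X))` of the
congruence kernel. -/
noncomputable def charIdem (D : LengthTwo R F) (ψ : AddChar F Kˣ) (A : Matrix n n F) :
    MonoidAlgebra K (GL n R) :=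
  (Fintype.card (Matrix n n F) : K)⁻¹ •
    ∑ X : Matrix n n F, (ψ (-(A * X).trace) : K) • of K (GL n R) (D.unip X)

section

variable (D : LengthTwo R F) (ψ : AddChar F Kˣ)

open MonoidAlgebra in
theorem of_unip_mul_charIdem (A X : Matrix n n F) :
    of K (GL n R) (D.unip X) * D.charIdem ψ A = (ψ (A * X).trace : K) • D.charIdem ψ A := by
  rw [charIdem, mul_smul_comm, smul_comm (ψ _ : K)]
  congr 1
  rw [Finset.mul_sum, Finset.smul_sum]
  refine Fintype.sum_equiv (Equiv.addLeft X) _ _ fun Y => ?_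
  rw [mul_smul_comm, ← map_mul, ← D.unip_add, smul_smul, ← Units.val_mul, ← AddChar.map_add_eq_mul]
  simp [mul_add]

open MonoidAlgebra in
theorem of_mul_charIdem (g : GL n R) (A : Matrix n n F) :
    of K (GL n R) g * D.charIdem ψ A =
      D.charIdem ψ (conjMat (D.red g) A) * of K (GL n R) g := by
  rw [charIdem, charIdem, mul_smul_comm, smul_mul_assoc, Finset.mul_sum, Finset.sum_mul]
  congr 1
  let e : Matrix n n F ≃ Matrix n n F :=
    ⟨conjMat (D.red g), conjMat (D.red g)⁻¹, fun X => by simp, fun X => by simp⟩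
  refine Fintype.sum_equiv e _ _ fun Y => ?_
  rw [mul_smul_comm, smul_mul_assoc, ← map_mul, ← map_mul, D.mul_unip, trace_conjMat_mul]
  change _ = (ψ (-(A * conjMat (D.red g)⁻¹ (conjMat (D.red g) Y)).trace) : K) • _
  rw [conjMat_inv_conjMat]
  rfl

variable [DecidableEq F]

theorem charIdem_mul_charIdem {ψ : AddChar F Kˣ} (hψ : ψ ≠ 1) (hF : (Fintype.card F : K) ≠ 0)
    (A B : Matrix n n F) :
    (D.charIdem ψ A * D.charIdem ψ B : MonoidAlgebra K (GL n R)) =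
      if A = B then D.charIdem ψ B else 0 := by
  conv_lhs => rw [charIdem]
  rw [smul_mul_assoc, Finset.sum_mul]
  simp_rw [smul_mul_assoc, D.of_unip_mul_charIdem, smul_smul, ← Finset.sum_smul, ← Units.val_mul,
    ← AddChar.map_add_eq_mul]
  have h : ∀ X : Matrix n n F, -(A * X).trace + (B * X).trace = ((B - A) * X).trace := fun X => by
    rw [sub_mul, Matrix.trace_sub]; ring
  simp_rw [h, sum_addChar_trace_mul hψ, sub_eq_zero, eq_comm (a := B)]
  split_ifs
  · rw [smul_smul, inv_mul_cancel₀ (card_matrix_ne_zero hF), one_smul]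
  · simp

theorem sum_charIdem {ψ : AddChar F Kˣ} (hψ : ψ ≠ 1) (hF : (Fintype.card F : K) ≠ 0) :
    ∑ A : Matrix n n F, (D.charIdem ψ A : MonoidAlgebra K (GL n R)) = 1 := by
  have h : ∀ A X : Matrix n n F, -(A * X).trace = (-X * A).trace := fun A X => by
    rw [neg_mul, Matrix.trace_neg, Matrix.trace_mul_comm]
  simp_rw [charIdem, ← Finset.smul_sum]
  rw [Finset.sum_comm]
  simp_rw [← Finset.sum_smul, h, sum_addChar_trace_mul hψ, neg_eq_zero, ite_smul, zero_smul]
  rw [Finset.sum_ite_eq' Finset.univ, if_pos (Finset.mem_univ _), smul_smul,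
    inv_mul_cancel₀ (card_matrix_ne_zero hF), one_smul, unip_zero, map_one]

theorem eq_of_mul_charIdem {ψ : AddChar F Kˣ} (hψ : ψ ≠ 1) (hF : (Fintype.card F : K) ≠ 0)
    {x y : MonoidAlgebra K (GL n R)} (h : ∀ A, x * D.charIdem ψ A = y * D.charIdem ψ A) :
    x = y := by
  rw [← mul_one x, ← mul_one y, ← D.sum_charIdem hψ hF, Finset.mul_sum, Finset.mul_sum]
  exact Finset.sum_congr rfl fun A _ => h A

/-- A cocycle on `GLₙ(R)` with values in the functions `Matrix n n F → Kˣ` (the units of the group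
algebra of the congruence kernel) extending the evaluation of characters. -/
structure IsCocycle (c : GL n R → Matrix n n F → Kˣ) : Prop where
  mul : ∀ g h A, c (g * h) A = c g (conjMat (D.red h) A) * c h A
  unip : ∀ X A, c (D.unip X) A = ψ (A * X).trace

end

variable (D : LengthTwo R F) (D' : LengthTwo R' F)

open MonoidAlgebra in
theorem IsCocycle.smul_congr {D : LengthTwo R F} {ψ : AddChar F Kˣ}
    {c : GL n R → Matrix n n F → Kˣ} (hc : D.IsCocycle ψ c)
    {g h : GL n R} (e : D.red g = D.red h) (A : Matrix n n F) :
    ((c g A)⁻¹ : Kˣ).val • (of K (GL n R) g * D.charIdem ψ A) =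
      ((c h A)⁻¹ : Kˣ).val • (of K (GL n R) h * D.charIdem ψ A) := by
  obtain ⟨X, rfl⟩ := D.exists_unip e
  rw [hc.mul, red_unip, conjMat_one, hc.unip, map_mul, mul_assoc, of_unip_mul_charIdem,
    mul_smul_comm, smul_smul, ← Units.val_mul, _root_.mul_inv_rev, mul_comm (ψ _)⁻¹,
    inv_mul_cancel_right]

variable [DecidableEq F]

open MonoidAlgebra in
theorem exists_algHom {ψ : AddChar F Kˣ} (hψ : ψ ≠ 1) (hF : (Fintype.card F : K) ≠ 0)
    {c : GL n R → Matrix n n F → Kˣ} {c' : GL n R' → Matrix n n F → Kˣ}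
    (hc : D.IsCocycle ψ c) (hc' : D'.IsCocycle ψ c') :
    ∃ Φ : MonoidAlgebra K (GL n R) →ₐ[K] MonoidAlgebra K (GL n R'),
      (∀ g g' A, D.red g = D'.red g' → Φ (of K _ g) * D'.charIdem ψ A =
        ((c g A * (c' g' A)⁻¹ : Kˣ) : K) • (of K _ g' * D'.charIdem ψ A)) ∧
      ∀ A, Φ (D.charIdem ψ A) = D'.charIdem ψ A := by
  choose l hl using fun g => D'.red_surjective (n := n) (D.red g)
  let f : GL n R → MonoidAlgebra K (GL n R') := fun g =>
    ∑ A, ((c g A * (c' (l g) A)⁻¹ : Kˣ) : K) • (of K _ (l g) * D'.charIdem ψ A)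
  have hf : ∀ g g' A, D.red g = D'.red g' → f g * D'.charIdem ψ A =
      ((c g A * (c' g' A)⁻¹ : Kˣ) : K) • (of K _ g' * D'.charIdem ψ A) := by
    intro g g' A h
    simp only [f, Finset.sum_mul, smul_mul_assoc, mul_assoc, D'.charIdem_mul_charIdem hψ hF]
    rw [Finset.sum_eq_single A (fun B _ hB => by simp [hB]) (by simp), if_pos rfl, Units.val_mul,
      Units.val_mul, mul_smul, mul_smul, hc'.smul_congr ((hl g).trans h)]
  have f_unip : ∀ X, f (D.unip X) = of K _ (D'.unip X) := by
    intro X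
    refine D'.eq_of_mul_charIdem hψ hF fun A => ?_
    rw [hf _ (D'.unip X) A (by simp), hc.unip, hc'.unip, mul_inv_cancel, Units.val_one, one_smul]
  have f_one : f 1 = 1 := by rw [← D.unip_zero, f_unip, unip_zero, map_one]
  have f_mul : ∀ g h, f (g * h) = f g * f h := by
    intro g h
    refine D'.eq_of_mul_charIdem hψ hF fun A => ?_
    have e : f g * f h * D'.charIdem ψ A =
        ((c h A * (c' (l h) A)⁻¹ : Kˣ) : K) •
          (((c g (conjMat (D.red h) A) * (c' (l g) (conjMat (D.red h) A))⁻¹ : Kˣ) : K) •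
            (of K _ (l g * l h) * D'.charIdem ψ A)) := by
      rw [mul_assoc, hf h (l h) A (hl h).symm, mul_smul_comm, of_mul_charIdem, ← mul_assoc, hl,
        hf g (l g) _ (hl g).symm, smul_mul_assoc, mul_assoc, ← hl, ← of_mul_charIdem, ← mul_assoc,
        ← map_mul]
    rw [e, hf (g * h) (l g * l h) A (by simp [hl]), smul_smul, ← Units.val_mul, hc.mul, hc'.mul, hl,
      mul_inv, mul_mul_mul_comm, mul_comm (c h A * _)]
  let Φ := MonoidAlgebra.lift K (MonoidAlgebra K (GL n R')) (GL n R)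
    { toFun := f, map_one' := f_one, map_mul' := f_mul }
  have hΦ : ∀ g, Φ (of K _ g) = f g := fun g => by simp [Φ]
  refine ⟨Φ, fun g g' A h => by rw [hΦ, hf g g' A h], fun A => ?_⟩
  simp only [charIdem, map_smul, map_sum, hΦ, f_unip]

open MonoidAlgebra in
/-- Group algebras of `GLₙ` over two rings of length two with the same residue field are
isomorphic as soon as both groups admit a cocycle extending the characters of the kernel. -/
theorem exists_algEquiv {ψ : AddChar F Kˣ} (hψ : ψ ≠ 1) (hF : (Fintype.card F : K) ≠ 0)
    {c : GL n R → Matrix n n F → Kˣ} {c' : GL n R' → Matrix n n F → Kˣ}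
    (hc : D.IsCocycle ψ c) (hc' : D'.IsCocycle ψ c') :
    Nonempty (MonoidAlgebra K (GL n R) ≃ₐ[K] MonoidAlgebra K (GL n R')) := by
  obtain ⟨Φ, h, he⟩ := D.exists_algHom D' hψ hF hc hc'
  obtain ⟨Φ', h', he'⟩ := D'.exists_algHom D hψ hF hc' hc
  refine ⟨AlgEquiv.ofAlgHom Φ Φ' ?_ ?_⟩
  · refine MonoidAlgebra.algHom_ext (fun g' => D'.eq_of_mul_charIdem hψ hF fun A => ?_) (by ext)
    obtain ⟨g, hg⟩ := D.red_surjective (D'.red g')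
    change Φ (Φ' (of K _ g')) * _ = of K _ g' * _
    rw [← he A, ← map_mul, h' g' g A hg.symm, map_smul, map_mul, he, h g g' A hg, smul_smul,
      ← Units.val_mul, mul_assoc, inv_mul_cancel_left, mul_inv_cancel, Units.val_one, one_smul]
  · refine MonoidAlgebra.algHom_ext (fun g => D.eq_of_mul_charIdem hψ hF fun A => ?_) (by ext)
    obtain ⟨g', hg⟩ := D'.red_surjective (D.red g)
    change Φ' (Φ (of K _ g)) * _ = of K _ g * _
    rw [← he' A, ← map_mul, h g g' A hg.symm, map_smul, map_mul, he', h' g' g A hg, smul_smul,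
      ← Units.val_mul, mul_assoc, inv_mul_cancel_left, mul_inv_cancel, Units.val_one, one_smul]

end LengthTwo

namespace LengthTwo

section

variable {R S k l M n : Type*} [CommRing R] [CommRing S] [Field k] [Field l] [CommGroup M]
  [Fintype n] [DecidableEq n]

theorem unip_mul (D : LengthTwo R k) (g : GL n R) (X : Matrix n n k) :
    D.unip X * g = g * D.unip (conjMat (D.red g)⁻¹ X) := by
  rw [mul_unip]
  exact congrArg (D.unip · * g) (conjMat_conjMat_inv _ X).symm

/-- The character `1 + ε X ↦ ψ (tr (A X))` of the congruence kernel extends to a multiplicative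
function on its stabilizer. -/
def Extends (D : LengthTwo R k) (ψ : AddChar k M) (A : Matrix n n k) : Prop :=
  ∃ Λ : GL n R → M,
    (∀ g h, conjMat (D.red g) A = A → conjMat (D.red h) A = A → Λ (g * h) = Λ g * Λ h) ∧
      ∀ X, Λ (D.unip X) = ψ (A * X).trace

theorem Extends.conjMat {D : LengthTwo R k} {ψ : AddChar k M} {A : Matrix n n k}
    (h : D.Extends ψ A) (P : GL n k) : D.Extends ψ (conjMat P A) := by
  obtain ⟨Λ, hmul, hunip⟩ := h
  obtain ⟨Q, rfl⟩ := D.red_surjective P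
  refine ⟨fun g => Λ (Q⁻¹ * g * Q), fun g h hg hh => ?_, fun X => ?_⟩
  · have key : ∀ g, LengthTwo.conjMat (D.red g) (LengthTwo.conjMat (D.red Q) A) =
        LengthTwo.conjMat (D.red Q) A → LengthTwo.conjMat (D.red (Q⁻¹ * g * Q)) A = A := by
      intro g hg
      rw [map_mul, map_mul, map_inv, conjMat_mul, conjMat_mul, hg, conjMat_inv_conjMat]
    rw [← hmul _ _ (key g hg) (key h hh)]
    simp only [mul_assoc, mul_inv_cancel_left]
  · beta_reduce
    rw [mul_assoc, unip_mul, inv_mul_cancel_left, hunip, trace_conjMat_mul]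

theorem Extends.of_map {D : LengthTwo R k} {E : LengthTwo S l} (φ : R →+* S) (i : k →+* l)
    (hπ : ∀ r, E.π (φ r) = i (D.π r)) (hε : ∀ x, φ (D.ε x) = E.ε (i x))
    {ψ : AddChar k M} {ψ' : AddChar l M} (hψ : ∀ x, ψ' (i x) = ψ x) {A : Matrix n n k}
    (h : E.Extends ψ' (A.map i)) : D.Extends ψ A := by
  obtain ⟨Λ, hmul, hunip⟩ := h
  have hred : ∀ g : GL n R, E.red (Matrix.GeneralLinearGroup.map φ g) =
      Matrix.GeneralLinearGroup.map i (D.red g) := fun g => by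
    ext; simp [hπ]
  have hconj : ∀ g : GL n R, LengthTwo.conjMat (D.red g) A = A →
      LengthTwo.conjMat (E.red (Matrix.GeneralLinearGroup.map φ g)) (A.map i) = A.map i := by
    intro g hg
    rw [conjMat_eq_iff_commute] at hg ⊢
    rw [hred]
    exact hg.map i.mapMatrix
  refine ⟨fun g => Λ (Matrix.GeneralLinearGroup.map φ g), fun g h hg hh => ?_, fun X => ?_⟩
  · beta_reduce
    rw [map_mul, hmul _ _ (hconj g hg) (hconj h hh)]
  · have : Matrix.GeneralLinearGroup.map φ (D.unip X) = E.unip (X.map i) := by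
      ext a b
      by_cases hab : a = b <;> simp [hε, hab]
    beta_reduce
    rw [this, hunip, ← hψ, ← Matrix.map_mul, ← AddMonoidHom.map_trace i]

/-- It suffices to extend the character to a subgroup which covers the stabilizer modulo the
congruence kernel, compatibly with the given values on the intersection. -/
theorem Extends.of_subgroup {D : LengthTwo R k} {ψ : AddChar k M} {A : Matrix n n k}
    (H : Subgroup (GL n R)) (χ : H →* M)
    (hχ : ∀ X (hX : D.unip X ∈ H), χ ⟨D.unip X, hX⟩ = ψ (A * X).trace)
    (hH : ∀ g, LengthTwo.conjMat g A = A → ∃ h ∈ H, D.red h = g) : D.Extends ψ A := by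
  have huniq : ∀ (h h' : H) (X X' : Matrix n n k), h.1 * D.unip X = h'.1 * D.unip X' →
      χ h * ψ (A * X).trace = χ h' * ψ (A * X').trace := by
    intro h h' X X' e
    have e' : h.1 = h'.1 * D.unip (X' - X) := by
      rw [eq_mul_inv_of_mul_eq e, mul_assoc]
      congr 1
      rw [mul_inv_eq_iff_eq_mul, ← unip_add, sub_add_cancel]
    have hm : D.unip (X' - X) ∈ H := by
      rw [← inv_mul_eq_of_eq_mul e']
      exact H.mul_mem (H.inv_mem h'.2) h.2
    have : h = h' * ⟨_, hm⟩ := Subtype.ext e'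
    rw [this, map_mul, hχ, mul_assoc, ← AddChar.map_add_eq_mul, ← Matrix.trace_add, ← mul_add,
      sub_add_cancel]
  have hex : ∀ g : GL n R, LengthTwo.conjMat (D.red g) A = A →
      ∃ (h : H) (X : Matrix n n k), g = h.1 * D.unip X := by
    intro g hg
    obtain ⟨h, hh, e⟩ := hH _ hg
    obtain ⟨X, hX⟩ := D.exists_unip e
    exact ⟨⟨h, hh⟩, X, hX⟩
  have hval : ∀ g : GL n R, ∃ m : M, ∀ (h : H) (X : Matrix n n k), g = h.1 * D.unip X →
      m = χ h * ψ (A * X).trace := by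
    intro g
    by_cases hg : ∃ (h : H) (X : Matrix n n k), g = h.1 * D.unip X
    · obtain ⟨h, X, rfl⟩ := hg
      exact ⟨_, fun h' X' e => huniq _ _ _ _ e⟩
    · exact ⟨1, fun h X e => absurd ⟨h, X, e⟩ hg⟩
  choose Λ hΛ using hval
  refine ⟨Λ, fun g g' hg hg' => ?_, fun X => ?_⟩
  · obtain ⟨h, X, rfl⟩ := hex g hg
    obtain ⟨h', X', rfl⟩ := hex g' hg'
    have e : h.1 * D.unip X * (h'.1 * D.unip X') =
        (h * h' : H).1 * D.unip (LengthTwo.conjMat (D.red h'.1)⁻¹ X + X') := by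
      rw [unip_add, mul_assoc, ← mul_assoc (D.unip X), unip_mul]
      simp only [mul_assoc, Subgroup.coe_mul]
    rw [map_mul, red_unip, mul_one] at hg'
    rw [hΛ _ _ _ e, hΛ _ h X rfl, hΛ _ h' X' rfl, mul_add, Matrix.trace_add,
      AddChar.map_add_eq_mul, ← trace_conjMat_mul, hg', map_mul, mul_mul_mul_comm]
  · rw [hΛ _ 1 X (by simp), map_one, one_mul]

end

section

variable {R k K n : Type*} [CommRing R] [Field k] [Field K] [Fintype n] [DecidableEq n]

theorem exists_isCocycle {D : LengthTwo R k} {ψ : AddChar k Kˣ}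
    (h : ∀ A : Matrix n n k, D.Extends ψ A) :
    ∃ c : GL n R → Matrix n n k → Kˣ, D.IsCocycle ψ c := by
  choose Λ hmul hunip using h
  let s : Setoid (Matrix n n k) :=
    { r := fun A B => ∃ g : GL n R, conjMat (D.red g) A = B
      iseqv :=
        { refl := fun A => ⟨1, by simp⟩
          symm := by
            rintro A _ ⟨g, rfl⟩
            exact ⟨g⁻¹, by simp⟩
          trans := by
            rintro A _ _ ⟨g, rfl⟩ ⟨h, rfl⟩
            exact ⟨h * g, by rw [map_mul, conjMat_mul]⟩ } }
  let rep : Matrix n n k → Matrix n n k := fun A => (Quotient.mk s A).out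
  have hrep : ∀ g A, rep (conjMat (D.red g) A) = rep A := fun g A =>
    congrArg Quotient.out (Quotient.sound (s := s) ⟨g, rfl⟩).symm
  have ht : ∀ A, ∃ t : GL n R, conjMat (D.red t) (rep A) = A := fun A =>
    Quotient.mk_out (s := s) A
  choose t ht using ht
  have ht' : ∀ A, conjMat (D.red (t A))⁻¹ A = rep A := fun A => by
    conv_lhs => rw [← congrArg (conjMat _) (ht A), conjMat_inv_conjMat]
  have hstab : ∀ g A,
      conjMat (D.red ((t (conjMat (D.red g) A))⁻¹ * g * t A)) (rep A) = rep A := fun g A => by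
    rw [map_mul, map_mul, conjMat_mul, conjMat_mul, ht, map_inv, ht', hrep]
  refine ⟨fun g A => Λ (rep A) ((t (conjMat (D.red g) A))⁻¹ * g * t A), fun g h A => ?_,
    fun X A => ?_⟩
  · have := hstab g (conjMat (D.red h) A)
    rw [hrep] at this
    rw [hrep, ← hmul _ _ _ this (hstab h A), map_mul, conjMat_mul]
    simp only [mul_assoc, mul_inv_cancel_left]
  · rw [red_unip, conjMat_one, mul_assoc, unip_mul, inv_mul_cancel_left, hunip,
      ← trace_conjMat_mul, ht]

end

theorem exists_monoidHom_comp_eq {A B K : Type*} [CommGroup A] [CommGroup B] [Field K]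
    [IsAlgClosed K] {f : A →* B} (hf : Function.Injective f) (g : A →* Kˣ) :
    ∃ h : B →* Kˣ, ∀ a, h (f a) = g a := by
  have hpow : ∀ {m : ℤ}, m ≠ 0 → Function.Surjective fun u : Kˣ => u ^ m := by
    have hnat : ∀ {m : ℕ}, m ≠ 0 → Function.Surjective fun u : Kˣ => u ^ m := by
      intro m hm u
      obtain ⟨z, hz⟩ := IsAlgClosed.exists_pow_nat_eq (u : K) (Nat.pos_of_ne_zero hm)
      have hz0 : z ≠ 0 := by
        rintro rfl
        exact u.ne_zero (by rw [← hz, zero_pow hm])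
      exact ⟨Units.mk0 z hz0, Units.ext (by simpa using hz)⟩
    intro m hm u
    obtain ⟨a, rfl | rfl⟩ := m.eq_nat_or_neg
    · simpa using hnat (by simpa using hm) u
    · obtain ⟨z, hz⟩ := hnat (by simpa using hm) u⁻¹
      exact ⟨z, by simpa using congrArg (·⁻¹) hz⟩
  let _ : DivisibleBy (Additive Kˣ) ℤ := divisibleByOfSMulRightSurj _ _ fun hm => hpow hm
  obtain ⟨h, hh⟩ := (Module.Baer.of_divisible (Additive Kˣ)).extension_property_addMonoidHom
    f.toAdditive hf g.toAdditive
  exact ⟨AddMonoidHom.toMultiplicative h, fun a => DFunLike.congr_fun hh a⟩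

theorem map_sum_eq_prod {A M ι : Type*} [AddCommMonoid A] [CommMonoid M] (ψ : AddChar A M)
    (s : Finset ι) (f : ι → A) : ψ (∑ i ∈ s, f i) = ∏ i ∈ s, ψ (f i) := by
  classical
  induction s using Finset.induction_on with
  | empty => simp
  | insert a s ha ih =>
    rw [Finset.sum_insert ha, Finset.prod_insert ha, AddChar.map_add_eq_mul, ih]

theorem toSquareBlock_mul {n R : Type*} [Fintype n] [CommRing R] {δ : n → ℕ} {M N : Matrix n n R}
    (hM : M.BlockTriangular δ) (hN : N.BlockTriangular δ) (i : ℕ) :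
    (M * N).toSquareBlock δ i = M.toSquareBlock δ i * N.toSquareBlock δ i := by
  refine (Matrix.toBlock_mul_eq_add _ (fun a => δ a = i) _ M N).trans (add_eq_left.2 ?_)
  ext ⟨a, ha⟩ ⟨b, hb⟩
  rw [Matrix.mul_apply, Matrix.zero_apply]
  refine Finset.sum_eq_zero fun c _ => ?_
  rw [Matrix.toBlock_apply, Matrix.toBlock_apply]
  obtain h | h := lt_or_gt_of_ne c.2
  · rw [hM (by rwa [ha]), zero_mul]
  · rw [hN (by rwa [hb]), mul_zero]

section

variable {R k n : Type*} [CommRing R] [Field k] [Fintype n] [DecidableEq n]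

/-- The group of invertible block triangular matrices. -/
def triangular (R : Type*) [CommRing R] (δ : n → ℕ) : Subgroup (GL n R) where
  carrier := {g | g.val.BlockTriangular δ}
  mul_mem' := fun hg hh => Matrix.BlockTriangular.mul hg hh
  one_mem' := Matrix.blockTriangular_one
  inv_mem' := fun {g} hg => by
    let _ := g.invertible
    change (g⁻¹.val).BlockTriangular δ
    rw [Matrix.coe_units_inv]
    exact Matrix.blockTriangular_inv_of_blockTriangular hg

/-- The determinant of a diagonal block, as a homomorphism on block triangular matrices. -/
noncomputable def detBlock (R : Type*) [CommRing R] (δ : n → ℕ) (i : ℕ) : triangular R δ →* Rˣ :=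
  MonoidHom.toHomUnits
    { toFun := fun g => (g.1.val.toSquareBlock δ i).det
      map_one' := by
        have : (1 : Matrix n n R).toSquareBlock δ i = 1 := by
          ext a b
          simp [Matrix.toSquareBlock_def, Matrix.one_apply, Subtype.ext_iff]
        simp [this]
      map_mul' := fun g h => by
        rw [← Matrix.det_mul, ← toSquareBlock_mul g.2 h.2]
        rfl }

/-- The embedding `x ↦ 1 + ε x` of the additive group of the residue field. -/
def oneAdd (D : LengthTwo R k) : Multiplicative k →* Rˣ :=
  MonoidHom.toHomUnits
    { toFun := fun x => 1 + D.ε x.toAdd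
      map_one' := by simp
      map_mul' := fun x y => by
        simp only [toAdd_mul, map_add]
        linear_combination -D.ε_mul_ε x.toAdd y.toAdd }

theorem coe_oneAdd (D : LengthTwo R k) (x : Multiplicative k) :
    (D.oneAdd x : R) = 1 + D.ε x.toAdd := rfl

theorem oneAdd_injective (D : LengthTwo R k) : Function.Injective D.oneAdd := fun _ _ h =>
  D.injective (add_left_cancel (congrArg Units.val h))

theorem detBlock_unip (D : LengthTwo R k) (δ : n → ℕ) (i : ℕ) (X : Matrix n n k)
    (hX : D.unip X ∈ triangular R δ) :
    detBlock R δ i ⟨D.unip X, hX⟩ =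
      D.oneAdd (Multiplicative.ofAdd (X.toSquareBlock δ i).trace) := by
  ext
  rw [coe_oneAdd, toAdd_ofAdd, ← det_one_add_mat]
  change ((D.unip X).val.toSquareBlock δ i).det = _
  congr 1
  ext a b
  simp [Matrix.toSquareBlock_def, Matrix.one_apply, Subtype.ext_iff]

theorem Extends.of_blocks {K : Type*} [Field K] [IsAlgClosed K] (D : LengthTwo R k)
    (ψ : AddChar k Kˣ) {B : Matrix n n k} (δ : n → ℕ) (μ : ℕ → k)
    (hB : ∀ i j, δ j ≤ δ i → B i j = if i = j then μ (δ i) else 0)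
    (hcomm : ∀ X : Matrix n n k, Commute X B → X.BlockTriangular δ) : D.Extends ψ B := by
  have hθ : ∀ i, ∃ θ : Rˣ →* Kˣ, ∀ x, θ (D.oneAdd x) = ψ (μ i * x.toAdd) := fun i =>
    exists_monoidHom_comp_eq D.oneAdd_injective
      { toFun := fun x => ψ (μ i * x.toAdd)
        map_one' := by simp
        map_mul' := fun x y => by simp [mul_add, AddChar.map_add_eq_mul] }
  choose θ hθ using hθ
  refine .of_subgroup (triangular R δ)
    (∏ i ∈ Finset.univ.image δ, (θ i).comp (detBlock R δ i)) (fun X hX => ?_) fun g hg => ?_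
  · have hX' : X.BlockTriangular δ := fun a b hab => by
      have := hX hab
      have hne : a ≠ b := by rintro rfl; exact lt_irrefl _ hab
      refine D.injective ?_
      simpa [hne] using this
    have htr : (B * X).trace =
        ∑ i ∈ Finset.univ.image δ, μ i * (X.toSquareBlock δ i).trace := by
      have h1 : ∀ a, (B * X) a a = μ (δ a) * X a a := fun a => by
        rw [Matrix.mul_apply, Finset.sum_eq_single a]
        · rw [hB a a le_rfl, if_pos rfl]
        · intro b _ hb
          obtain h | h := le_or_gt (δ b) (δ a)
          · rw [hB a b h, if_neg hb.symm, zero_mul]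
          · rw [hX' h, mul_zero]
        · simp
      simp_rw [Matrix.trace, Matrix.diag_apply, h1]
      rw [← Finset.sum_fiberwise_of_maps_to (s := Finset.univ) (g := δ)
        (fun a _ => Finset.mem_image_of_mem δ (Finset.mem_univ a))]
      refine Finset.sum_congr rfl fun i _ => ?_
      rw [Finset.mul_sum, ← Finset.sum_subtype_eq_sum_filter, Finset.subtype_univ]
      exact Finset.sum_congr rfl fun a _ => by rw [a.2]; rfl
    rw [MonoidHom.finsetProd_apply, htr, map_sum_eq_prod]
    exact Finset.prod_congr rfl fun i _ => by
      rw [MonoidHom.comp_apply, detBlock_unip, hθ, toAdd_ofAdd]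
  · choose s hs using D.surjective
    obtain ⟨h, hh, hg'⟩ := D.exists_lift g (fun x => open Classical in if x = 0 then 0 else s x)
      fun x => by split_ifs with hx <;> simp [hx, hs]
    refine ⟨h, fun a b hab => ?_, hg'⟩
    rw [hh, Matrix.map_apply, hcomm _ (conjMat_eq_iff_commute.1 hg) hab, if_pos rfl]

end

open Polynomial in
theorem exists_eq_prod_range {k : Type*} [Field k] [IsAlgClosed k] {p : k[X]} (hp : p.Monic) :
    ∃ (μ : ℕ → k) (r : ℕ), p = ∏ j ∈ Finset.range r, (X - C (μ j)) := by
  refine ⟨fun j => p.roots.toList.getD j 0, p.roots.toList.length, ?_⟩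
  have h : p = (p.roots.toList.map fun a => X - C a).prod := by
    conv_lhs => rw [(IsAlgClosed.splits p).eq_prod_roots_of_monic hp, ← Multiset.coe_toList p.roots]
    simp
  rw [Finset.prod_range]
  conv_lhs => rw [h, ← Fin.prod_univ_fun_getElem]
  exact Finset.prod_congr rfl fun j _ => by
    beta_reduce
    rw [List.getD_eq_getElem _ _ j.2]

/-- A basis adapted to a finite flag of subspaces. -/
theorem exists_basis_of_flag {n k V : Type*} [Field k] [AddCommGroup V] [Module k V]
    (e : Module.Basis n k V) {W : ℕ → Submodule k V} (hW : Monotone W) (h0 : W 0 = ⊥) {r : ℕ}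
    (hr : W r = ⊤) :
    ∃ (b : Module.Basis n k V) (δ : n → ℕ), (∀ j, b j ∈ W (δ j + 1)) ∧
      ∀ m, W m ≤ Submodule.span k (b '' {j | δ j < m}) := by
  have key : ∀ r, ∃ s : Set V, LinearIndepOn k id s ∧
      ∀ m ≤ r, W m ≤ Submodule.span k (s ∩ W m) := by
    intro r
    induction r with
    | zero => exact ⟨∅, linearIndepOn_empty k _, fun m hm => by simp [Nat.le_zero.1 hm, h0]⟩
    | succ r ih =>
      obtain ⟨s, hs, hsW⟩ := ih
      obtain ⟨t, ht, hst, htW, hli⟩ := exists_linearIndepOn_id_extension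
        (hs.mono (Set.inter_subset_left (t := (W r : Set V))))
        (Set.inter_subset_right.trans (hW r.le_succ) : s ∩ W r ⊆ (W (r + 1) : Set V))
      refine ⟨t, hli, fun m hm => ?_⟩
      obtain h | rfl := Nat.le_succ_iff.1 hm
      · exact (hsW m h).trans (Submodule.span_mono
          fun v hv => ⟨hst ⟨hv.1, hW h hv.2⟩, hv.2⟩)
      · rw [Set.inter_eq_left.2 ht]
        exact htW
  obtain ⟨s, hs, hsW⟩ := key r
  have hW' : ∀ m, W m ≤ Submodule.span k (s ∩ W m) := fun m => by
    obtain h | h := le_total m r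
    · exact hsW m h
    · have hm : W m = W r := le_antisymm (hr ▸ le_top) (hW h)
      rw [hm]
      exact hsW r le_rfl
  let b' : Module.Basis s k V := Module.Basis.mk (v := ((↑) : s → V)) hs (by
    rw [Subtype.range_coe, ← hr]
    exact (hW' r).trans (Submodule.span_mono Set.inter_subset_left))
  have hex : ∀ v : V, ∃ m, v ∈ W (m + 1) := fun v => ⟨r, hW r.le_succ (hr ▸ trivial)⟩
  classical
  refine ⟨b'.reindex (b'.indexEquiv e), fun j => Nat.find (hex (b'.reindex (b'.indexEquiv e) j)),
    fun j => Nat.find_spec (hex _), fun m => ?_⟩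
  obtain _ | m := m
  · simp [h0]
  · refine (hW' _).trans (Submodule.span_mono ?_)
    rintro v ⟨hvs, hv⟩
    have hb : b'.reindex (b'.indexEquiv e) (b'.indexEquiv e ⟨v, hvs⟩) = v := by
      rw [Module.Basis.reindex_apply, Equiv.symm_apply_apply]
      exact Module.Basis.mk_apply _ _ _
    refine ⟨b'.indexEquiv e ⟨v, hvs⟩, ?_, hb⟩
    exact Nat.lt_succ_of_le (Nat.find_min' _ (by rwa [hb]))

open Polynomial in
/-- Over an algebraically closed field, every matrix is conjugate to a block upper triangular
matrix with scalar diagonal blocks, in such a way that its centralizer is block upper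
triangular. -/
theorem exists_conjMat_eq {n k : Type*} [Fintype n] [DecidableEq n] [Field k] [IsAlgClosed k]
    (A : Matrix n n k) :
    ∃ (P : GL n k) (B : Matrix n n k) (δ : n → ℕ) (μ : ℕ → k), conjMat P B = A ∧
      (∀ i j, δ j ≤ δ i → B i j = if i = j then μ (δ i) else 0) ∧
      ∀ X : Matrix n n k, Commute X B → X.BlockTriangular δ := by
  let f := Matrix.toLin' A
  obtain ⟨μ, r, hμ⟩ := exists_eq_prod_range f.charpoly_monic
  let q : ℕ → k[X] := fun m => ∏ j ∈ Finset.range m, (X - C (μ j))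
  have hq : ∀ m, q (m + 1) = q m * (X - C (μ m)) := fun m => Finset.prod_range_succ _ _
  let W : ℕ → Submodule k (n → k) := fun m => LinearMap.ker (aeval f (q m))
  have hWf : ∀ {m v}, v ∈ W (m + 1) → f v - μ m • v ∈ W m := by
    intro m v hv
    simpa [W, hq, LinearMap.mem_ker, Module.algebraMap_end_apply] using hv
  have hW : Monotone W := monotone_nat_of_le_succ fun m v hv => by
    rw [LinearMap.mem_ker] at hv ⊢
    rw [hq, mul_comm, map_mul, Module.End.mul_apply, hv, map_zero]
  have hWg : ∀ {g : Module.End k (n → k)}, Commute g f → ∀ {m v}, v ∈ W m → g v ∈ W m := by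
    intro g hg m v hv
    rw [LinearMap.mem_ker] at hv ⊢
    have : Commute g (aeval f (q m)) := by
      rw [aeval_eq_sum_range]
      exact .sum_right _ _ _ fun i _ => (hg.pow_right i).smul_right _
    rw [← Module.End.mul_apply, ← this.eq, Module.End.mul_apply, hv, map_zero]
  obtain ⟨b, δ, hb, hδ⟩ := exists_basis_of_flag (Pi.basisFun k n) hW (r := r)
    (by simp [W, q, Module.End.one_eq_id]) (by
      have : aeval f (q r) = 0 := by
        rw [← f.aeval_self_charpoly, hμ]
      simp [W, this])
  have hrepr : ∀ {m v i}, v ∈ W m → m ≤ δ i → b.repr v i = 0 := by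
    intro m v i hv hi
    by_contra h
    exact (not_lt.2 hi) (b.mem_span_image.1 (hδ m hv) (Finsupp.mem_support_iff.2 h))
  refine ⟨⟨(Pi.basisFun k n).toMatrix b, b.toMatrix (Pi.basisFun k n), ?_, ?_⟩,
    LinearMap.toMatrix b b f, δ, μ, ?_, fun i j hij => ?_, fun Y hY i j hij => ?_⟩
  · exact Module.Basis.toMatrix_mul_toMatrix_flip _ _
  · exact Module.Basis.toMatrix_mul_toMatrix_flip _ _
  · exact (basis_toMatrix_mul_linearMap_toMatrix_mul_basis_toMatrix _ _ _ _ f).trans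
      (LinearMap.toMatrix'_toLin' A)
  · have h := hrepr (hWf (hb j)) hij
    rw [map_sub, map_smul, Finsupp.sub_apply, Finsupp.smul_apply, b.repr_self, sub_eq_zero] at h
    rw [LinearMap.toMatrix_apply, h, smul_eq_mul]
    split_ifs with hij'
    · rw [hij', Finsupp.single_eq_same, mul_one]
    · rw [Finsupp.single_eq_of_ne hij', mul_zero]
  · have hg : Commute (Matrix.toLin b b Y) f := by
      have : f = Matrix.toLin b b (LinearMap.toMatrix b b f) := (Matrix.toLin_toMatrix b b f).symm
      rw [this]
      exact hY.map (Matrix.toLinAlgEquiv b)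
    have := hrepr (hWg hg (hb j)) hij
    rwa [← LinearMap.toMatrix_apply b b, LinearMap.toMatrix_toLin] at this

theorem extends_of_isAlgClosed {R k K n : Type*} [CommRing R] [Field k] [IsAlgClosed k] [Field K]
    [IsAlgClosed K] [Fintype n] [DecidableEq n] (D : LengthTwo R k) (ψ : AddChar k Kˣ)
    (A : Matrix n n k) : D.Extends ψ A := by
  obtain ⟨P, B, δ, μ, rfl, hB, hcomm⟩ := exists_conjMat_eq A
  exact (Extends.of_blocks D ψ δ μ hB hcomm).conjMat P

section

variable {k K n : Type*} [Field k] [Field K] [Fintype n]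

variable (k) in
/-- The ring of dual numbers as a square-zero extension. -/
def dualNumber : LengthTwo (DualNumber k) k where
  π := (TrivSqZeroExt.fstHom k k k).toRingHom
  ε := (TrivSqZeroExt.inrHom k k).toAddMonoidHom
  surjective x := ⟨TrivSqZeroExt.inl x, rfl⟩
  injective := TrivSqZeroExt.inr_injective
  π_ε _ := rfl
  exists_ε r hr := ⟨r.snd, TrivSqZeroExt.ext hr.symm rfl⟩
  mul_ε r x := TrivSqZeroExt.ext (mul_zero _) (by
    change r.fst • x + MulOpposite.op (0 : k) • r.snd = r.fst * x
    simp)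

theorem map_snd_mul (M N : Matrix n n (DualNumber k)) :
    (M * N).map TrivSqZeroExt.snd = M.map TrivSqZeroExt.fst * N.map TrivSqZeroExt.snd +
      M.map TrivSqZeroExt.snd * N.map TrivSqZeroExt.fst := by
  ext i j
  simp [Matrix.mul_apply, TrivSqZeroExt.snd_sum, Finset.sum_add_distrib, mul_comm]

/-- Over the dual numbers, `g ↦ g₀⁻¹ g₁` is a crossed homomorphism, giving an explicit cocycle. -/
theorem isCocycle_dualNumber [DecidableEq n] (ψ : AddChar k Kˣ) :
    (dualNumber k).IsCocycle ψ fun (g : GL n (DualNumber k)) A =>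
      ψ (A * (((dualNumber k).red g)⁻¹.val * g.val.map TrivSqZeroExt.snd)).trace where
  mul g h A := by
    rw [← AddChar.map_add_eq_mul, trace_conjMat_mul, ← Matrix.trace_add, ← mul_add, Units.val_mul,
      map_snd_mul]
    change ψ (A * (_ * ((((dualNumber k).red g).val * _ + _ * ((dualNumber k).red h).val)))).trace
      = _
    rw [map_mul, _root_.mul_inv_rev, Units.val_mul, mul_add, mul_assoc _ _ (_ * _),
      Units.inv_mul_cancel_left, conjMat, inv_inv, add_comm]
    simp only [mul_assoc]
  unip X A := by
    have : ((dualNumber k).unip X).val.map TrivSqZeroExt.snd = X := by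
      ext i j
      by_cases h : i = j <;> simp [dualNumber, h]
    rw [red_unip, this, inv_one, Units.val_one, one_mul]

end

section

variable (p : ℕ) [Fact p.Prime] (k : Type*) [Field k]

theorem truncatedWittVector_ext (p : ℕ) (k : Type*) {x y : TruncatedWittVector p 2 k}
    (h₀ : x.coeff (0 : Fin 2) = y.coeff (0 : Fin 2))
    (h₁ : x.coeff (1 : Fin 2) = y.coeff (1 : Fin 2)) : x = y :=
  TruncatedWittVector.ext (Fin.forall_fin_two.2 ⟨h₀, h₁⟩)

/-- The residue map on Witt vectors of length two. -/
noncomputable def residue : TruncatedWittVector p 2 k →+* k :=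
  have key : ∀ v : WittVector p k, (WittVector.truncate 2 v).coeff (0 : Fin 2) = v.coeff 0 :=
    fun v => WittVector.coeff_truncate v 0
  { toFun := fun x => x.coeff (0 : Fin 2)
    map_one' := by rw [← map_one (WittVector.truncate 2), key, WittVector.one_coeff_zero]
    map_mul' := fun x y => by
      obtain ⟨v, rfl⟩ := WittVector.truncate_surjective p 2 k x
      obtain ⟨w, rfl⟩ := WittVector.truncate_surjective p 2 k y
      rw [← map_mul, key, key, key, WittVector.mul_coeff_zero]
    map_zero' := by rw [← map_zero (WittVector.truncate 2), key, WittVector.zero_coeff]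
    map_add' := fun x y => by
      obtain ⟨v, rfl⟩ := WittVector.truncate_surjective p 2 k x
      obtain ⟨w, rfl⟩ := WittVector.truncate_surjective p 2 k y
      rw [← map_add, key, key, key, WittVector.add_coeff_zero] }

theorem residue_truncate (v : WittVector p k) :
    residue p k (WittVector.truncate 2 v) = v.coeff 0 :=
  WittVector.coeff_truncate v 0

variable [CharP k p]

theorem coeff_zero_truncate_mul_natCast (v : WittVector p k) :
    (WittVector.truncate 2 (v * (p : WittVector p k))).coeff (0 : Fin 2) = 0 :=
  (WittVector.coeff_truncate (v * (p : WittVector p k)) 0).trans (WittVector.mul_charP_coeff_zero v)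

theorem coeff_one_truncate_mul_natCast (v : WittVector p k) :
    (WittVector.truncate 2 (v * (p : WittVector p k))).coeff (1 : Fin 2) = v.coeff 0 ^ p :=
  (WittVector.coeff_truncate (v * (p : WittVector p k)) 1).trans
    (WittVector.mul_charP_coeff_succ v 0)

theorem truncate_mul_natCast_congr {v w : WittVector p k} (h : v.coeff 0 = w.coeff 0) :
    WittVector.truncate 2 (v * (p : WittVector p k)) =
      WittVector.truncate 2 (w * (p : WittVector p k)) := by
  apply truncatedWittVector_ext
  · rw [coeff_zero_truncate_mul_natCast, coeff_zero_truncate_mul_natCast]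
  · rw [coeff_one_truncate_mul_natCast, coeff_one_truncate_mul_natCast, h]

/-- The additive map `x ↦ [x] p` into the Witt vectors of length two. -/
noncomputable def verschiebung : k →+ TruncatedWittVector p 2 k :=
  AddMonoidHom.mk'
    (fun x => WittVector.truncate 2 (WittVector.teichmuller p x * (p : WittVector p k)))
    fun x y => by
    rw [← map_add, ← add_mul]
    apply truncate_mul_natCast_congr
    simp only [WittVector.add_coeff_zero, WittVector.teichmuller_coeff_zero]

theorem verschiebung_apply (x : k) :
    verschiebung p k x =
      WittVector.truncate 2 (WittVector.teichmuller p x * (p : WittVector p k)) := rfl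

theorem coeff_one_verschiebung (x : k) : (verschiebung p k x).coeff (1 : Fin 2) = x ^ p := by
  rw [verschiebung_apply, coeff_one_truncate_mul_natCast, WittVector.teichmuller_coeff_zero]

theorem residue_verschiebung (x : k) : residue p k (verschiebung p k x) = 0 := by
  rw [verschiebung_apply, residue_truncate, WittVector.mul_charP_coeff_zero]

/-- The ring of Witt vectors of length two over a perfect field as a square-zero extension. -/
noncomputable def wittVector [PerfectRing k p] : LengthTwo (TruncatedWittVector p 2 k) k where
  π := residue p k
  ε := verschiebung p k
  surjective x := ⟨WittVector.truncate 2 (WittVector.teichmuller p x), by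
    rw [residue_truncate, WittVector.teichmuller_coeff_zero]⟩
  injective x y h := by
    apply (PerfectRing.bijective_frobenius (R := k) (p := p)).1
    change x ^ p = y ^ p
    rw [← coeff_one_verschiebung, h, coeff_one_verschiebung]
  π_ε := residue_verschiebung p k
  exists_ε r hr := by
    obtain ⟨x, hx⟩ := (PerfectRing.bijective_frobenius (R := k) (p := p)).2 (r.coeff (1 : Fin 2))
    exact ⟨x, truncatedWittVector_ext p k ((residue_verschiebung p k x).trans hr.symm)
      ((coeff_one_verschiebung p k x).trans hx)⟩
  mul_ε r x := by
    obtain ⟨v, rfl⟩ := WittVector.truncate_surjective p 2 k r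
    rw [verschiebung_apply, verschiebung_apply, residue_truncate, ← map_mul, ← mul_assoc]
    apply truncate_mul_natCast_congr
    simp only [WittVector.mul_coeff_zero, WittVector.teichmuller_coeff_zero]

/-- Functoriality of truncated Witt vectors. -/
noncomputable def mapTruncated {k l : Type*} [Field k] [Field l] (m : ℕ) (f : k →+* l) :
    TruncatedWittVector p m k →+* TruncatedWittVector p m l :=
  have key : ∀ v : WittVector p k, (TruncatedWittVector.mk p fun i =>
      f ((WittVector.truncate m v).coeff i)) = WittVector.truncate m (WittVector.map f v) :=
    fun v => by ext i; simp
  { toFun := fun x => TruncatedWittVector.mk p fun i => f (x.coeff i)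
    map_one' := by rw [← map_one (WittVector.truncate m), key, map_one, map_one]
    map_mul' := fun x y => by
      obtain ⟨v, rfl⟩ := WittVector.truncate_surjective p m k x
      obtain ⟨w, rfl⟩ := WittVector.truncate_surjective p m k y
      simp only [← map_mul, key]
    map_zero' := by rw [← map_zero (WittVector.truncate m), key, map_zero, map_zero]
    map_add' := fun x y => by
      obtain ⟨v, rfl⟩ := WittVector.truncate_surjective p m k x
      obtain ⟨w, rfl⟩ := WittVector.truncate_surjective p m k y
      simp only [← map_add, key] }

theorem mapTruncated_truncate {k l : Type*} [Field k] [Field l] (m : ℕ) (f : k →+* l)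
    (v : WittVector p k) :
    mapTruncated p m f (WittVector.truncate m v) = WittVector.truncate m (WittVector.map f v) := by
  ext i
  simp [mapTruncated]

theorem extends_wittVector [PerfectRing k p] {K n : Type*} [Field K] [IsAlgClosed K] [Fintype n]
    [DecidableEq n] (ψ : AddChar k Kˣ) (A : Matrix n n k) : (wittVector p k).Extends ψ A := by
  let i := algebraMap k (AlgebraicClosure k)
  have : CharP (AlgebraicClosure k) p := charP_of_injective_algebraMap i.injective p
  have : ExpChar (AlgebraicClosure k) p := ExpChar.prime Fact.out
  have : PerfectRing (AlgebraicClosure k) p := PerfectField.toPerfectRing p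
  obtain ⟨χ, hχ⟩ := exists_monoidHom_comp_eq
    (f := i.toAddMonoidHom.toMultiplicative) i.injective ψ.toMonoidHom
  refine .of_map (E := wittVector p (AlgebraicClosure k)) (mapTruncated p 2 i) i (fun r => ?_)
    (fun x => ?_) (ψ' := AddChar.toMonoidHomEquiv.symm χ) (fun x => hχ (Multiplicative.ofAdd x))
    (extends_of_isAlgClosed _ _ _)
  · rfl
  · change mapTruncated p 2 i (verschiebung p k x) = verschiebung p _ (i x)
    rw [verschiebung_apply, mapTruncated_truncate, map_mul, WittVector.map_teichmuller, map_natCast,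
      verschiebung_apply]

end

end LengthTwo

theorem exists_addChar_ne_one (p : ℕ) [Fact p.Prime] (F : Type*) [Field F] [CharP F p]
    {K : Type*} [Field K] [IsAlgClosed K] (hK : (p : K) ≠ 0) : ∃ ψ : AddChar F Kˣ, ψ ≠ 1 := by
  have : NeZero (p : K) := ⟨hK⟩
  obtain ⟨ζ, hζ⟩ := HasEnoughRootsOfUnity.exists_primitiveRoot K p
  obtain ⟨u, rfl⟩ := hζ.isUnit (NeZero.ne p)
  rw [IsPrimitiveRoot.coe_units_iff] at hζ
  let i := ZMod.castHom dvd_rfl F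
  obtain ⟨χ, hχ⟩ := LengthTwo.exists_monoidHom_comp_eq
    (f := i.toAddMonoidHom.toMultiplicative) i.injective
    (AddChar.zmodChar p hζ.pow_eq_one).toMonoidHom
  refine ⟨AddChar.toMonoidHomEquiv.symm χ, fun h => hζ.ne_one (Fact.out : p.Prime).one_lt ?_⟩
  have h1 : χ (Multiplicative.ofAdd (i 1)) = 1 := DFunLike.congr_fun h (i 1)
  have h2 := (hχ (Multiplicative.ofAdd 1)).symm.trans h1
  have h3 : u ^ (1 : ZMod p).val = 1 := h2
  rwa [ZMod.val_one, pow_one] at h3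

theorem nonempty_algEquiv_GL_dualNumber_wittVector (p : ℕ) [Fact p.Prime] (F : Type*) [Field F]
    [Finite F] [CharP F p] (n : Type*) [Fintype n] [DecidableEq n] {K : Type*} [Field K]
    [IsAlgClosed K] (hK : (p : K) ≠ 0) :
    Nonempty (MonoidAlgebra K (GL n (DualNumber F)) ≃ₐ[K]
      MonoidAlgebra K (GL n (TruncatedWittVector p 2 F))) := by
  classical
  have := Fintype.ofFinite F
  have : ExpChar F p := ExpChar.prime Fact.out
  have : PerfectRing F p := PerfectField.toPerfectRing p
  obtain ⟨ψ, hψ⟩ := exists_addChar_ne_one p F hK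
  obtain ⟨c, hc⟩ := LengthTwo.exists_isCocycle (n := n)
    (LengthTwo.extends_wittVector p F ψ)
  obtain ⟨m, -, hm⟩ := FiniteField.card F p
  exact LengthTwo.exists_algEquiv (LengthTwo.dualNumber F) (LengthTwo.wittVector p F) hψ
    (by rw [hm, Nat.cast_pow]; exact pow_ne_zero _ hK) (LengthTwo.isCocycle_dualNumber ψ) hc

section

variable {K G H : Type*} [Field K] [Group G] [Group H]

theorem map_mem_center (e : MonoidAlgebra K G ≃ₐ[K] MonoidAlgebra K H) {b : MonoidAlgebra K G}
    (hb : b ∈ Subalgebra.center K (MonoidAlgebra K G)) :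
    e b ∈ Subalgebra.center K (MonoidAlgebra K H) := by
  rw [Subalgebra.mem_center_iff] at hb ⊢
  intro y
  rw [← e.apply_symm_apply y, ← map_mul, hb, map_mul]

theorem IsBlock.map (e : MonoidAlgebra K G ≃ₐ[K] MonoidAlgebra K H) {b : MonoidAlgebra K G}
    (hb : IsBlock K G b) : IsBlock K H (e b) := by
  obtain ⟨h0, hc, hi, hp⟩ := hb
  refine ⟨(map_ne_zero_iff e e.injective).2 h0, map_mem_center e hc, hi.map e,
    fun b₁ b₂ hc₁ hc₂ hi₁ hi₂ hb hm => ?_⟩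
  simpa using hp (e.symm b₁) (e.symm b₂) (map_mem_center e.symm hc₁) (map_mem_center e.symm hc₂)
    (hi₁.map e.symm) (hi₂.map e.symm) (by rw [← map_add, ← hb, e.symm_apply_apply])
    (by rw [← map_mul, hm, map_zero])

/-- An isomorphism of group algebras permutes the blocks. -/
noncomputable def blockEquiv (e : MonoidAlgebra K G ≃ₐ[K] MonoidAlgebra K H) :
    {b : MonoidAlgebra K G // IsBlock K G b} ≃ {b : MonoidAlgebra K H // IsBlock K H b} where
  toFun b := ⟨e b.1, b.2.map e⟩
  invFun b := ⟨e.symm b.1, b.2.map e.symm⟩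
  left_inv b := Subtype.ext (e.symm_apply_apply b.1)
  right_inv b := Subtype.ext (e.apply_symm_apply b.1)

/-- The isomorphism of block algebras induced by an isomorphism of group algebras. -/
noncomputable def blockAlgebraMap (e : MonoidAlgebra K G ≃ₐ[K] MonoidAlgebra K H)
    {b : MonoidAlgebra K G} (hb : b ∈ Subalgebra.center K (MonoidAlgebra K G)) :
    blockAlgebra K G b hb →ₙₐ[K] blockAlgebra K H (e b) (map_mem_center e hb) where
  toFun x := ⟨e x.1, (map_mul e b x.1).symm.trans (congrArg e x.2)⟩
  map_smul' c x := Subtype.ext (map_smul e c x.1)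
  map_zero' := Subtype.ext (map_zero e)
  map_add' x y := Subtype.ext (map_add e x.1 y.1)
  map_mul' x y := Subtype.ext (map_mul e x.1 y.1)

theorem blockAlgebraMap_bijective (e : MonoidAlgebra K G ≃ₐ[K] MonoidAlgebra K H)
    {b : MonoidAlgebra K G} (hb : b ∈ Subalgebra.center K (MonoidAlgebra K G)) :
    Function.Bijective (blockAlgebraMap e hb) := by
  refine ⟨fun x y h => Subtype.ext (e.injective (congrArg Subtype.val h)), fun y => ?_⟩
  refine ⟨⟨e.symm y.1, e.injective ?_⟩, Subtype.ext (e.apply_symm_apply y.1)⟩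
  rw [map_mul, e.apply_symm_apply]
  exact y.2

end

/-- **Proposition 5.3 for `GLₙ`.** For `q = p ^ d` and `K` algebraically closed with
`char K ≠ p`, there is a bijection `Φ` between the blocks of
`K[GLₙ(𝔽_q[t]/t²)]` and those of `K[GLₙ(W₂(𝔽_q))]` such that for every block `b` the
block algebras `b·K[G]` and `Φ(b)·K[G']` are isomorphic as `K`-algebras (the isomorphism
matching the identity elements `b` and `Φ b`). -/
theorem blocks_bijection_GL_dualNumber_wittVector
    (p d n : ℕ) [Fact p.Prime] (hd : 1 ≤ d) (hn : 1 ≤ n) (q : ℕ) (hq : q = p ^ d)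
    (K : Type*) [Field K] [IsAlgClosed K] (hK : ringChar K ≠ p) :
    ∃ Φ : {b : MonoidAlgebra K (GL (Fin n) (DualNumber (GaloisField p d))) //
            IsBlock K (GL (Fin n) (DualNumber (GaloisField p d))) b} ≃
          {b' : MonoidAlgebra K (GL (Fin n) (TruncatedWittVector p 2 (GaloisField p d))) //
            IsBlock K (GL (Fin n) (TruncatedWittVector p 2 (GaloisField p d))) b'},
      ∀ b, ∃ f : blockAlgebra K _ b.1 b.2.2.1 →ₙₐ[K] blockAlgebra K _ (Φ b).1 (Φ b).2.2.1,
        Function.Bijective f ∧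
          f ⟨b.1, b.2.2.2.1⟩ = ⟨(Φ b).1, (Φ b).2.2.2.1⟩ := by
  have hp : (p : K) ≠ 0 := fun h => by
    rcases (Nat.dvd_prime Fact.out).1 ((ringChar.spec K p).1 h) with h1 | h1
    · exact CharP.ringChar_ne_one h1
    · exact hK h1
  obtain ⟨e⟩ := nonempty_algEquiv_GL_dualNumber_wittVector p (GaloisField p d) (Fin n) hp
  exact ⟨blockEquiv e, fun b => ⟨blockAlgebraMap e b.2.2.1, blockAlgebraMap_bijective e _, rfl⟩⟩
end

section
/- Let K be a field, n ≥ 1, H a group, and let Φ : H →* (Matrix (Fin n) (Fin n) K ≃ₐ[K] Matrix (Fin n) (Fin n) K) be an action of H on the matrix algebra M_n(K) by K-algebra automorphisms. Then there exist a map s : H → GL_n(K) and a function α : H → H → Kˣ such that for all h ∈ H and all M ∈ M_n(K), Φ(h)(M) = s(h) · M · s(h)⁻¹, and for all g, h ∈ H, s(g) · s(h) = α(g,h) • s(gh). -/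
open Matrix

/-- **Skolem–Noether** for matrix algebras: every algebra automorphism is inner. -/
theorem Matrix.exists_algEquiv_eq_conj {K ι : Type*} [Field K] [Fintype ι] [DecidableEq ι]
    (f : Matrix ι ι K ≃ₐ[K] Matrix ι ι K) :
    ∃ u : GL ι K, ∀ M : Matrix ι ι K, f M = u.val * M * (u⁻¹).val := by
  let e : ((ι → K) →ₗ[K] ι → K) ≃ₐ[K] Matrix ι ι K := LinearMap.toMatrixAlgEquiv'
  obtain ⟨T, hT⟩ := ((e.trans f).trans e.symm).eq_linearEquivConjAlgEquiv
  refine ⟨Units.map e.toMonoidHom (LinearMap.GeneralLinearGroup.ofLinearEquiv T), fun M ↦ ?_⟩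
  have h : e.symm (f (e (e.symm M))) = T.toLinearMap * e.symm M * T.symm.toLinearMap :=
    congr($hT (e.symm M))
  rw [AlgEquiv.apply_symm_apply, AlgEquiv.symm_apply_eq, map_mul, map_mul,
    AlgEquiv.apply_symm_apply] at h
  exact h

/-- Invertible matrices inducing the same inner automorphism differ by a scalar unit. -/
theorem Matrix.GeneralLinearGroup.exists_eq_smul_of_conj_eq {R ι : Type*} [CommRing R]
    [Fintype ι] [DecidableEq ι] {u v : GL ι R}
    (h : ∀ M : Matrix ι ι R, u.val * M * (u⁻¹).val = v.val * M * (v⁻¹).val) :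
    ∃ c : Rˣ, u.val = (c : R) • v.val := by
  have hc : v⁻¹ * u ∈ Subgroup.center (GL ι R) := by
    refine Subgroup.mem_center_iff.mpr fun g ↦ ?_
    have hg : u * g * u⁻¹ = v * g * v⁻¹ := Units.ext (h g.val)
    rw [mul_inv_eq_iff_eq_mul] at hg
    rw [mul_assoc v⁻¹, hg]
    group
  rw [center_eq_range_scalar] at hc
  obtain ⟨c, hc⟩ := hc
  refine ⟨c, ?_⟩
  have hu : u = v * scalar ι c := by rw [hc, mul_inv_cancel_left]
  rw [hu]
  ext i j
  simp [mul_comm]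

/-- **Skolem–Noether mechanism behind Proposition 4.1.** If a group `H` acts on the matrix
algebra `Mₙ(K)` by `K`-algebra automorphisms, then there are matrices `s h ∈ GLₙ(K)`
implementing each automorphism by conjugation, and scalars `α g h ∈ Kˣ` measuring the
failure of `s` to be multiplicative: `s g * s h = α g h • s (g * h)`. -/
theorem exists_projective_rep_of_algAut_action
    (K : Type*) [Field K] (n : ℕ) (hn : 1 ≤ n) (H : Type*) [Group H]
    (Φ : H →* (Matrix (Fin n) (Fin n) K ≃ₐ[K] Matrix (Fin n) (Fin n) K)) :
    ∃ (s : H → GL (Fin n) K) (α : H → H → Kˣ),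
      (∀ (h : H) (M : Matrix (Fin n) (Fin n) K),
        Φ h M = (↑(s h) : Matrix (Fin n) (Fin n) K) * M * (↑((s h)⁻¹) : Matrix (Fin n) (Fin n) K)) ∧
      (∀ g h : H,
        (↑(s g) : Matrix (Fin n) (Fin n) K) * (↑(s h) : Matrix (Fin n) (Fin n) K) =
          (α g h : K) • (↑(s (g * h)) : Matrix (Fin n) (Fin n) K)) := by
  choose s hs using fun h ↦ Matrix.exists_algEquiv_eq_conj (Φ h)
  have hconj (g h : H) (M : Matrix (Fin n) (Fin n) K) :
      (s g * s h).val * M * ((s g * s h)⁻¹).val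
        = (s (g * h)).val * M * ((s (g * h))⁻¹).val := by
    rw [← hs, map_mul, AlgEquiv.mul_apply, hs h, hs g, _root_.mul_inv_rev,
      Units.val_mul, Units.val_mul]
    simp only [mul_assoc]
  choose α hα using fun g h ↦ Matrix.GeneralLinearGroup.exists_eq_smul_of_conj_eq (hconj g h)
  exact ⟨s, α, hs, hα⟩
end

section
/- Let p be a prime, d ≥ 1, q = p^d. Let A be a finite commutative local ring whose maximal ideal m satisfies m² = 0, |A/m| = q, and |A| = q². Then A is isomorphic as a ring either to DualNumber (GaloisField p d) (the dual numbers 𝔽_q[t]/(t²)) or to TruncatedWittVector p 2 (GaloisField p d) (the ring W₂(𝔽_q) of Witt vectors of length two over 𝔽_q); the first case occurs exactly when A has characteristic p and the second exactly when A has characteristic p². -/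
section

variable {A F : Type*} [CommRing A] [Field F] {π : A →+* F}

/-- If the kernel of a surjection onto a finite field is square-zero and has at most as many
elements as the field, then it is generated by each of its nonzero elements. -/
theorem exists_mul_eq_of_mem_ker_of_card [Finite A] [Finite F] (hπ : Function.Surjective π)
    (hsq : RingHom.ker π ^ 2 = ⊥) (hcard : Nat.card A ≤ Nat.card F ^ 2)
    {t : A} (ht : t ∈ RingHom.ker π) (ht0 : t ≠ 0) {x : A} (hx : x ∈ RingHom.ker π) :
    ∃ a, a * t = x := by
  have hmul : ∀ a ∈ RingHom.ker π, a * t = 0 := fun a ha ↦ by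
    have h := Ideal.mul_mem_mul ha ht
    rwa [← pow_two, hsq, Ideal.mem_bot] at h
  have hker : Nat.card (RingHom.ker π) ≤ Nat.card F := by
    have h1 := Submodule.card_eq_card_quotient_mul_card (RingHom.ker π)
    have h2 : Nat.card (A ⧸ RingHom.ker π) = Nat.card F :=
      Nat.card_congr (RingHom.quotientKerEquivOfSurjective hπ).toEquiv
    rw [h2] at h1
    have h3 : 0 < Nat.card F := Nat.card_pos
    nlinarith
  let g : F → RingHom.ker π := fun y ↦
    ⟨Function.surjInv hπ y * t, Ideal.mul_mem_left _ _ ht⟩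
  have hg : Function.Injective g := fun y z hyz ↦ by
    by_contra hne
    have h0 : (Function.surjInv hπ y - Function.surjInv hπ z) * t = 0 := by
      rw [sub_mul, sub_eq_zero]
      exact congrArg Subtype.val hyz
    obtain ⟨b, hb⟩ := hπ (y - z)⁻¹
    have h1 : b * (Function.surjInv hπ y - Function.surjInv hπ z) - 1 ∈ RingHom.ker π := by
      simp [RingHom.mem_ker, hb, Function.surjInv_eq hπ, inv_mul_cancel₀ (sub_ne_zero.2 hne)]
    have h2 := hmul _ h1
    rw [sub_mul, mul_assoc, h0] at h2
    simp at h2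
    exact ht0 h2
  have hb : Function.Bijective g :=
    hg.bijective_of_nat_card_le hker
  obtain ⟨y, hy⟩ := hb.2 ⟨x, hx⟩
  exact ⟨_, congrArg Subtype.val hy⟩

variable (p : ℕ) [Fact p.Prime]

theorem pow_prime_eq_zero_of_mem_of_sq_eq_bot {I : Ideal A} (hsq : I ^ 2 = ⊥) {a : A}
    (ha : a ∈ I) : a ^ p = 0 := by
  have h := Ideal.pow_mem_pow ha 2
  rw [hsq, Ideal.mem_bot] at h
  exact pow_eq_zero_of_le (Fact.out : p.Prime).two_le h

/-- A surjection onto a field of characteristic `p` with square-zero kernel induces a ring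
homomorphism from the Witt vectors of length two, through the first ghost component. -/
theorem exists_truncatedWittVector_hom [CharP F p] (hπ : Function.Surjective π)
    (hsq : RingHom.ker π ^ 2 = ⊥) :
    ∃ f : TruncatedWittVector p 2 F →+* A, ∀ x : WittVector p A,
      f (WittVector.truncate 2 (WittVector.map π x)) = x.coeff 0 ^ p + p * x.coeff 1 := by
  let φ : WittVector p A →+* TruncatedWittVector p 2 F :=
    (WittVector.truncate 2).comp (WittVector.map π)
  have hφ : Function.Surjective φ :=
    (WittVector.truncate_surjective p 2 F).comp (WittVector.map_surjective π hπ)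
  have hgh : ∀ x : WittVector p A,
      WittVector.ghostComponent 1 x = x.coeff 0 ^ p + p * x.coeff 1 := fun x ↦ by
    rw [WittVector.ghostComponent_apply, wittPolynomial_eq_sum_C_mul_X_pow]
    simp [Finset.sum_range_succ]
  have hp : (p : A) ∈ RingHom.ker π := by simp [RingHom.mem_ker]
  have hker : RingHom.ker φ ≤ RingHom.ker (WittVector.ghostComponent (p := p) (R := A) 1) := by
    intro x hx
    have hx' := (WittVector.mem_ker_truncate 2 (WittVector.map π x)).1 hx
    have h0 : x.coeff 0 ∈ RingHom.ker π := by simpa using hx' 0 (by norm_num)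
    have h1 : x.coeff 1 ∈ RingHom.ker π := by simpa using hx' 1 (by norm_num)
    have h2 := Ideal.mul_mem_mul hp h1
    rw [← pow_two, hsq, Ideal.mem_bot] at h2
    rw [RingHom.mem_ker, hgh, h2, pow_prime_eq_zero_of_mem_of_sq_eq_bot p hsq h0, add_zero]
  refine ⟨φ.liftOfSurjective hφ ⟨WittVector.ghostComponent 1, hker⟩, fun x ↦ ?_⟩
  rw [← hgh]
  exact φ.liftOfRightInverse_comp_apply _ _ ⟨WittVector.ghostComponent 1, hker⟩ x

variable [Finite A] [Finite F] [CharP F p]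

theorem nonempty_ringEquiv_truncatedWittVector (hπ : Function.Surjective π)
    (hsq : RingHom.ker π ^ 2 = ⊥) (hcard : Nat.card A = Nat.card F ^ 2) (hp : (p : A) ≠ 0) :
    Nonempty (A ≃+* TruncatedWittVector p 2 F) := by
  obtain ⟨f, hf⟩ := exists_truncatedWittVector_hom p hπ hsq
  have hpm : (p : A) ∈ RingHom.ker π := by simp [RingHom.mem_ker]
  have hsurj : Function.Surjective f := fun a ↦ by
    obtain ⟨y, hy⟩ := (bijective_frobenius F p).2 (π a)
    obtain ⟨b, rfl⟩ := hπ y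
    have hab : a - b ^ p ∈ RingHom.ker π := by
      rw [RingHom.mem_ker, map_sub, map_pow, ← hy, frobenius_def, sub_self]
    obtain ⟨c, hc⟩ := exists_mul_eq_of_mem_ker_of_card hπ hsq hcard.le hpm hp hab
    refine ⟨_, (hf (WittVector.mk p fun n ↦ if n = 0 then b else c)).trans ?_⟩
    simp only [WittVector.coeff_mk, if_true, one_ne_zero, if_false]
    rw [mul_comm, hc]
    ring
  have : Finite (TruncatedWittVector p 2 F) := inferInstanceAs (Finite (Fin 2 → F))
  have hc : Nat.card (TruncatedWittVector p 2 F) ≤ Nat.card A := by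
    rw [hcard]
    exact (Nat.card_fun (α := Fin 2) (β := F)).trans (by simp) |>.le
  exact ⟨(RingEquiv.ofBijective f (hsurj.bijective_of_nat_card_le hc)).symm⟩

theorem nonempty_ringEquiv_dualNumber (hπ : Function.Surjective π)
    (hsq : RingHom.ker π ^ 2 = ⊥) (hcard : Nat.card A = Nat.card F ^ 2) (hp : (p : A) = 0) :
    Nonempty (A ≃+* DualNumber F) := by
  have : Nontrivial A := hπ.nontrivial
  have : CharP A p := (CharP.charP_iff_prime_eq_zero Fact.out).2 hp
  have hker : RingHom.ker π ≤ RingHom.ker (frobenius A p) := fun a ha ↦ by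
    rw [RingHom.mem_ker, frobenius_def, pow_prime_eq_zero_of_mem_of_sq_eq_bot p hsq ha]
  let s : F →+* A := π.liftOfSurjective hπ ⟨frobenius A p, hker⟩
  have hs : ∀ a, s (π a) = a ^ p := fun a ↦
    π.liftOfRightInverse_comp_apply _ _ ⟨frobenius A p, hker⟩ a
  have hmod : ∀ a, ∃ y, a - s y ∈ RingHom.ker π := fun a ↦ by
    obtain ⟨y, hy⟩ := (bijective_frobenius F p).2 (π a)
    obtain ⟨b, rfl⟩ := hπ y
    exact ⟨π b, by rw [RingHom.mem_ker, map_sub, hs, map_pow, ← hy, frobenius_def, sub_self]⟩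
  obtain ⟨t, ht, ht0⟩ : ∃ t ∈ RingHom.ker π, t ≠ 0 := by
    by_contra! h
    have hinj : Function.Injective π := (injective_iff_map_eq_zero π).2 h
    have h1 := Nat.card_congr (Equiv.ofBijective π ⟨hinj, hπ⟩)
    have h2 : 1 < Nat.card F := Finite.one_lt_card
    nlinarith
  have hmul : ∀ a ∈ RingHom.ker π, a * t = 0 := fun a ha ↦ by
    have h := Ideal.mul_mem_mul ha ht
    rwa [← pow_two, hsq, Ideal.mem_bot] at h
  algebraize [s]
  let f : DualNumber F →ₐ[F] A := DualNumber.lift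
    ⟨(Algebra.ofId F A, t), hmul t ht, fun _ ↦ Commute.all _ _⟩
  have hf : ∀ x y, f (TrivSqZeroExt.inl x + TrivSqZeroExt.inr y) = s x + s y * t := by
    intro x y
    rw [DualNumber.lift_apply_apply, TrivSqZeroExt.fst_add, TrivSqZeroExt.snd_add,
      TrivSqZeroExt.fst_inl, TrivSqZeroExt.fst_inr, TrivSqZeroExt.snd_inl, TrivSqZeroExt.snd_inr,
      add_zero, zero_add]
    rfl
  have hsurj : Function.Surjective f := fun a ↦ by
    obtain ⟨x, hx⟩ := hmod a
    obtain ⟨c, hc⟩ := exists_mul_eq_of_mem_ker_of_card hπ hsq hcard.le ht ht0 hx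
    obtain ⟨y, hy⟩ := hmod c
    refine ⟨_, (hf x y).trans ?_⟩
    have h := hmul _ hy
    linear_combination hc - h
  have : Finite (DualNumber F) := inferInstanceAs (Finite (F × F))
  have hc : Nat.card (DualNumber F) ≤ Nat.card A := by
    rw [hcard, pow_two]
    exact (Nat.card_prod F F).le
  exact ⟨(RingEquiv.ofBijective f (hsurj.bijective_of_nat_card_le hc)).symm⟩

end

/-- **Lemma 2.1 of Stasinski–Vera-Gajardo.** A finite commutative local ring of length two
with residue field of cardinality `q = p ^ d` is isomorphic either to the dual numbers
`𝔽_q[t]/(t²)` or to the Witt vectors `W₂(𝔽_q)` of length two; the first happens exactly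
when the characteristic is `p`, the second exactly when it is `p²`. -/
theorem local_ring_length_two_classification
    (p d : ℕ) [Fact p.Prime] (hd : 1 ≤ d) (q : ℕ) (hq : q = p ^ d)
    (A : Type*) [CommRing A] [IsLocalRing A] [Fintype A]
    (hm : (IsLocalRing.maximalIdeal A) ^ 2 = ⊥)
    (hres : Nat.card (A ⧸ IsLocalRing.maximalIdeal A) = q)
    (hcard : Nat.card A = q ^ 2) :
    (Nonempty (A ≃+* DualNumber (GaloisField p d)) ∨
        Nonempty (A ≃+* TruncatedWittVector p 2 (GaloisField p d))) ∧
      (Nonempty (A ≃+* DualNumber (GaloisField p d)) ↔ ringChar A = p) ∧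
      (Nonempty (A ≃+* TruncatedWittVector p 2 (GaloisField p d)) ↔ ringChar A = p ^ 2) := by
  have hpp : p.Prime := Fact.out
  have hF : Nat.card (GaloisField p d) = q := by
    rw [hq, GaloisField.card p d (Nat.one_le_iff_ne_zero.1 hd)]
  let e : IsLocalRing.ResidueField A ≃+* GaloisField p d := by
    have : Fintype (GaloisField p d) := Fintype.ofFinite _
    have : Finite (IsLocalRing.ResidueField A) :=
      Finite.of_surjective _ IsLocalRing.residue_surjective
    have : Fintype (IsLocalRing.ResidueField A) := Fintype.ofFinite _
    refine FiniteField.ringEquivOfCardEq ?_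
    rw [← Nat.card_eq_fintype_card, ← Nat.card_eq_fintype_card, hF]
    exact hres
  let π : A →+* GaloisField p d := e.toRingHom.comp (IsLocalRing.residue A)
  have hπ : Function.Surjective π := e.surjective.comp IsLocalRing.residue_surjective
  have hker : RingHom.ker π = IsLocalRing.maximalIdeal A := by
    ext a
    simp [π, RingHom.mem_ker]
  have hsq : RingHom.ker π ^ 2 = ⊥ := by rw [hker, hm]
  rw [← hF] at hcard
  have hp2 : ((p ^ 2 : ℕ) : A) = 0 := by
    have hp : (p : A) ∈ RingHom.ker π := by simp [RingHom.mem_ker]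
    have h := Ideal.pow_mem_pow hp 2
    rwa [hsq, Ideal.mem_bot, ← Nat.cast_pow] at h
  have hchar : ringChar A = p ↔ (p : A) = 0 :=
    ⟨fun h ↦ h ▸ ringChar.Nat.cast_ringChar,
      fun h ↦ ((Nat.dvd_prime hpp).1 (ringChar.dvd h)).resolve_left CharP.ringChar_ne_one⟩
  have hchar2 : ringChar A = p ^ 2 ↔ (p : A) ≠ 0 := by
    refine ⟨fun h h0 ↦ ?_, fun h ↦ ?_⟩
    · have := h.symm.trans (hchar.2 h0)
      have := hpp.one_lt
      nlinarith
    · obtain ⟨k, hk, hk'⟩ := (Nat.dvd_prime_pow hpp).1 (ringChar.dvd hp2)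
      interval_cases k
      · exact absurd hk' (by simpa using CharP.ringChar_ne_one)
      · exact absurd (hchar.1 (by simpa using hk')) h
      · exact hk'
  have hD : Nonempty (A ≃+* DualNumber (GaloisField p d)) ↔ (p : A) = 0 := by
    refine ⟨fun ⟨g⟩ ↦ g.injective ?_, nonempty_ringEquiv_dualNumber p hπ hsq hcard⟩
    rw [map_natCast, map_zero, ← TrivSqZeroExt.inl_natCast, CharP.cast_eq_zero,
      TrivSqZeroExt.inl_zero]
  have hW : Nonempty (A ≃+* TruncatedWittVector p 2 (GaloisField p d)) ↔ (p : A) ≠ 0 := by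
    refine ⟨fun ⟨g⟩ h ↦ ?_, nonempty_ringEquiv_truncatedWittVector p hπ hsq hcard⟩
    have h1 : (p : TruncatedWittVector p 2 (GaloisField p d)) ^ 1 = 0 := by
      rw [pow_one, ← map_natCast g, h, map_zero]
    have := TruncatedWittVector.eq_of_le_of_cast_pow_eq_zero p 2 _ 1 one_le_two h1
    omega
  rw [hchar, hchar2, hD, hW]
  exact ⟨em _, Iff.rfl, Iff.rfl⟩
end
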